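/- arXiv:2106.05347 — 6 statements merged into one kernel-verified Lean document; each statement's English description precedes it below -/
import Mathlib

section
/- There exists a constant C > 0 such that for every integer r ∈ {4,5,6} and every integer n ≥ r there exists an (n,r,2)-system H with independence number α(H) ≤ C · n^{0.973}. -/
/-- `H` is an `(r,s)`-system (design) on vertex type `V`: every edge has `r` vertices and
every pair of distinct edges intersects in fewer than `s` vertices. -/
def IsDesign {V : Type*} [DecidableEq V] (r s : ℕ) (H : Finset (Finset V)) : Prop :=
  (∀ e ∈ H, e.card = r) ∧ ∀ e ∈ H, ∀ f ∈ H, e ≠ f → (e ∩ f).card < s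

/-- The independence number of `H` is at most `α`: every set containing no edge has
size at most `α`. -/
def IndepAtMost {V : Type*} (H : Finset (Finset V)) (α : ℝ) : Prop :=
  ∀ S : Finset V, (∀ e ∈ H, ¬ e ⊆ S) → (S.card : ℝ) ≤ α

open Finset in
theorem aux_pair_count {E : Type*} [Fintype E] [Nonempty E] [DecidableEq E] (M : ℕ) (i j : Fin M)
    (hij : i ≠ j) (a b : E) :
    (∑ f : Fin M → E, if f i = a ∧ f j = b then (1 : ℝ) else 0) * (Fintype.card E : ℝ) ^ 2
      = (Fintype.card E : ℝ) ^ M := by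
  have hN : (Fintype.card E : ℝ) ≠ 0 := by exact_mod_cast Fintype.card_ne_zero
  set N : ℝ := (Fintype.card E : ℝ) with hNdef
  let g : Fin M → E → ℝ := fun k x =>
    (if k = i then (if x = a then 1 else 0) else 1) * (if k = j then (if x = b then 1 else 0) else 1)
  have h1 : ∀ f : Fin M → E, (if f i = a ∧ f j = b then (1 : ℝ) else 0) = ∏ k, g k (f k) := by
    intro f
    simp only [g, Finset.prod_mul_distrib, Finset.prod_ite_eq', Finset.mem_univ, if_true]
    by_cases h1 : f i = a <;> by_cases h2 : f j = b <;> simp [h1, h2]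
  have h2 : ∀ k, ∑ x, g k x = N * (if k = i then N⁻¹ else 1) * (if k = j then N⁻¹ else 1) := by
    intro k
    by_cases h1 : k = i
    · have h2 : k ≠ j := h1 ▸ hij
      simp [g, h1, hij, hN]
    · by_cases h2 : k = j
      · simp [g, h2, hij.symm, hN]
      · simp [g, h1, h2, hNdef]
  have h3 : ∑ f : Fin M → E, ∏ k, g k (f k) = ∏ k, ∑ x, g k x := by
    rw [Finset.prod_univ_sum]
    simp
  rw [Finset.sum_congr rfl (fun f _ => h1 f), h3, Finset.prod_congr rfl (fun k _ => h2 k)]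
  simp only [Finset.prod_mul_distrib, Finset.prod_ite_eq', Finset.mem_univ, if_true]
  simp
  field_simp

open Finset Classical in
theorem aux_random {E I : Type*} [Fintype E] [Nonempty E] [Fintype I] (M t : ℕ) (b p : ℝ)
    (hb : 0 < b) (R : E → E → Prop) (P : I → E → Prop)
    (hR : (M : ℝ) ^ 2 * (#{x : E × E | R x.1 x.2} : ℝ) ≤ b * (Fintype.card E : ℝ) ^ 2)
    (hp : p ≤ 1)
    (hP : ∀ s, p * Fintype.card E ≤ (#{e | P s e} : ℝ))
    (hI : (Fintype.card I : ℝ) * 2 ^ t * (1 - p / 2) ^ M < 1 / 2) :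
    ∃ f : Fin M → E, (#{x : Fin M × Fin M | x.1 ≠ x.2 ∧ R (f x.1) (f x.2)} : ℝ) ≤ 2 * b ∧
      ∀ s, t < #{i | P s (f i)} := by
  by_contra hcon
  push Not at hcon
  have hN : (0 : ℝ) < Fintype.card E := by exact_mod_cast Fintype.card_pos
  set N : ℝ := (Fintype.card E : ℝ) with hNdef
  -- pointwise bound
  have hpt : ∀ f : Fin M → E, (1 : ℝ) ≤
      (#{x : Fin M × Fin M | x.1 ≠ x.2 ∧ R (f x.1) (f x.2)} : ℝ) / (2 * b)
        + ∑ s : I, (2 : ℝ) ^ t * ∏ i, (if P s (f i) then (1 / 2 : ℝ) else 1) := by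
    intro f
    have hnn : ∀ s : I, 0 ≤ (2 : ℝ) ^ t * ∏ i, (if P s (f i) then (1 / 2 : ℝ) else 1) := by
      intro s
      refine mul_nonneg (by positivity) (Finset.prod_nonneg fun i _ => ?_)
      split_ifs <;> norm_num
    by_cases h : (#{x : Fin M × Fin M | x.1 ≠ x.2 ∧ R (f x.1) (f x.2)} : ℝ) ≤ 2 * b
    · obtain ⟨s, hs⟩ := hcon f h
      have h1 : (1 : ℝ) ≤ (2 : ℝ) ^ t * ∏ i, (if P s (f i) then (1 / 2 : ℝ) else 1) := by
        rw [Finset.prod_ite]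
        simp only [Finset.prod_const, one_pow, mul_one]
        calc (1 : ℝ) = 2 ^ t * (1 / 2) ^ t := by rw [← mul_pow]; norm_num
          _ ≤ _ := by
            apply mul_le_mul_of_nonneg_left _ (by positivity)
            exact pow_le_pow_of_le_one (by norm_num) (by norm_num) hs
      have h2 := Finset.single_le_sum (f := fun s => (2 : ℝ) ^ t * ∏ i, (if P s (f i) then (1 / 2 : ℝ) else 1)) (fun s _ => hnn s) (Finset.mem_univ s)
      have h3 : 0 ≤ (#{x : Fin M × Fin M | x.1 ≠ x.2 ∧ R (f x.1) (f x.2)} : ℝ) / (2 * b) := by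
        positivity
      linarith
    · push Not at h
      have h3 : 1 ≤ (#{x : Fin M × Fin M | x.1 ≠ x.2 ∧ R (f x.1) (f x.2)} : ℝ) / (2 * b) := by
        rw [le_div_iff₀ (by positivity)]; linarith
      have := Finset.sum_nonneg (s := Finset.univ) (fun s _ => hnn s)
      linarith
  have hsum := Finset.sum_le_sum (s := (Finset.univ : Finset (Fin M → E))) (fun f _ => hpt f)
  rw [Finset.sum_add_distrib] at hsum
  have hL : ∑ f : Fin M → E, (1 : ℝ) = N ^ M := by simp [hNdef]
  rw [hL] at hsum
  -- first term
  have hpair : ∀ x : Fin M × Fin M, x.1 ≠ x.2 →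
      ∑ f : Fin M → E, (if R (f x.1) (f x.2) then (1 : ℝ) else 0)
        = (#{x : E × E | R x.1 x.2} : ℝ) * (N ^ M / N ^ 2) := by
    intro x hx
    have h1 : ∀ f : Fin M → E, (if R (f x.1) (f x.2) then (1 : ℝ) else 0)
        = ∑ y ∈ ({x : E × E | R x.1 x.2} : Finset (E × E)), if f x.1 = y.1 ∧ f x.2 = y.2 then (1 : ℝ) else 0 := by
      intro f
      have : ∀ y : E × E, (f x.1 = y.1 ∧ f x.2 = y.2) ↔ (f x.1, f x.2) = y := by
        intro y; rw [Prod.ext_iff]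
      simp only [this, Finset.sum_ite_eq]
      simp
    rw [Finset.sum_congr rfl (fun f _ => h1 f), Finset.sum_comm]
    rw [Finset.sum_congr rfl (fun y _ => (eq_div_iff (by positivity)).2 (aux_pair_count M x.1 x.2 hx y.1 y.2))]
    simp [hNdef]
  have hfirst : ∑ f : Fin M → E, (#{x : Fin M × Fin M | x.1 ≠ x.2 ∧ R (f x.1) (f x.2)} : ℝ) / (2 * b)
      ≤ N ^ M / 2 := by
    rw [← Finset.sum_div]
    have h1 : ∀ f : Fin M → E, (#{x : Fin M × Fin M | x.1 ≠ x.2 ∧ R (f x.1) (f x.2)} : ℝ)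
        = ∑ x ∈ ({x : Fin M × Fin M | x.1 ≠ x.2} : Finset _), if R (f x.1) (f x.2) then (1 : ℝ) else 0 := by
      intro f
      rw [← Finset.filter_filter, Finset.card_filter]
      push_cast
      rfl
    rw [Finset.sum_congr rfl (fun f _ => h1 f), Finset.sum_comm]
    rw [Finset.sum_congr rfl (fun x hx => hpair x (Finset.mem_filter.1 hx).2)]
    rw [Finset.sum_const, nsmul_eq_mul]
    have h2 : (#{x : Fin M × Fin M | x.1 ≠ x.2} : ℝ) ≤ (M : ℝ) ^ 2 := by
      have := Finset.card_le_univ ({x : Fin M × Fin M | x.1 ≠ x.2} : Finset _)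
      simp only [Fintype.card_prod, Fintype.card_fin] at this
      rw [sq]; exact_mod_cast this
    rw [div_le_iff₀ (by positivity)]
    calc _ ≤ (M : ℝ) ^ 2 * ((#{x : E × E | R x.1 x.2} : ℝ) * (N ^ M / N ^ 2)) := by
          apply mul_le_mul_of_nonneg_right h2 (by positivity)
      _ = ((M : ℝ) ^ 2 * (#{x : E × E | R x.1 x.2} : ℝ)) * (N ^ M / N ^ 2) := by ring
      _ ≤ (b * N ^ 2) * (N ^ M / N ^ 2) := by
          apply mul_le_mul_of_nonneg_right hR (by positivity)
      _ = _ := by field_simp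
  -- second term
  have hsec : ∑ f : Fin M → E, ∑ s : I, (2 : ℝ) ^ t * ∏ i, (if P s (f i) then (1 / 2 : ℝ) else 1)
      ≤ (Fintype.card I : ℝ) * 2 ^ t * (1 - p / 2) ^ M * N ^ M := by
    rw [Finset.sum_comm]
    have h1 : ∀ s : I, ∑ f : Fin M → E, (2 : ℝ) ^ t * ∏ i, (if P s (f i) then (1 / 2 : ℝ) else 1)
        ≤ 2 ^ t * ((1 - p / 2) ^ M * N ^ M) := by
      intro s
      rw [← Finset.mul_sum]
      apply mul_le_mul_of_nonneg_left _ (by positivity)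
      have h3 : ∑ f : Fin M → E, ∏ i, (if P s (f i) then (1 / 2 : ℝ) else 1)
          = ∏ _i : Fin M, ∑ x : E, (if P s x then (1 / 2 : ℝ) else 1) := by
        rw [Finset.prod_univ_sum]
        simp
      rw [h3, Finset.prod_const, Finset.card_univ, Fintype.card_fin, ← mul_pow]
      apply pow_le_pow_left₀
      · apply Finset.sum_nonneg
        intro x _
        split_ifs <;> norm_num
      · have h4 : ∑ x : E, (if P s x then (1 / 2 : ℝ) else 1)
            = N - (#{e | P s e} : ℝ) / 2 := by
          have : ∀ x : E, (if P s x then (1 / 2 : ℝ) else 1) = 1 - (if P s x then (1 : ℝ) else 0) / 2 := by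
            intro x; split_ifs <;> norm_num
          rw [Finset.sum_congr rfl (fun x _ => this x), Finset.sum_sub_distrib, ← Finset.sum_div,
            Finset.sum_boole]
          simp [hNdef]
        rw [h4]
        have := hP s
        linarith
    refine (Finset.sum_le_sum (fun s _ => h1 s)).trans ?_
    rw [Finset.sum_const, nsmul_eq_mul, Finset.card_univ]
    apply le_of_eq; ring
  have hNM : 0 < N ^ M := by positivity
  have := mul_lt_mul_of_pos_right hI hNM
  linarith

open Finset in
theorem aux_superset {n r : ℕ} (T : Finset (Fin n)) (hT : #T = 2) :
    #{e : {e : Finset (Fin n) // #e = r} | T ⊆ e.1} ≤ (n - 2).choose (r - 2) := by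
  have : (n - 2).choose (r - 2) = #(powersetCard (r - 2) (univ \ T)) := by
    rw [card_powersetCard, card_univ_sdiff, hT, Fintype.card_fin]
  rw [this]
  apply Finset.card_le_card_of_injOn (fun e => e.1 \ T)
  · intro e he
    have he : T ⊆ e.1 := by simpa using he
    simp only [mem_coe, mem_powersetCard]
    refine ⟨sdiff_subset_sdiff (subset_univ _) subset_rfl, ?_⟩
    rw [card_sdiff_of_subset he, hT, e.2]
  · intro e he f hf hef
    have he : T ⊆ e.1 := by simpa using he
    have hf : T ⊆ f.1 := by simpa using hf
    apply Subtype.ext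
    have hef : e.1 \ T = f.1 \ T := hef
    rw [← sdiff_union_of_subset he, ← sdiff_union_of_subset hf, hef]

open Finset in
theorem aux_R {n r : ℕ} (hr : 2 ≤ r) (hn : r ≤ n) :
    (#{x : {e : Finset (Fin n) // #e = r} × {e : Finset (Fin n) // #e = r} |
      2 ≤ #(x.1.1 ∩ x.2.1)}) * n.choose 2 ≤ (r.choose 2) ^ 2 * (n.choose r) ^ 2 := by
  have hch : n.choose r * r.choose 2 = n.choose 2 * (n - 2).choose (r - 2) :=
    Nat.choose_mul hr
  have h1 : #{x : {e : Finset (Fin n) // #e = r} × {e : Finset (Fin n) // #e = r} |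
      2 ≤ #(x.1.1 ∩ x.2.1)} ≤ n.choose r * (r.choose 2 * (n - 2).choose (r - 2)) := by
    have hsub : ({x : {e : Finset (Fin n) // #e = r} × {e : Finset (Fin n) // #e = r} |
      2 ≤ #(x.1.1 ∩ x.2.1)} : Finset _) ⊆ (univ : Finset {e : Finset (Fin n) // #e = r}).biUnion
        (fun e => (powersetCard 2 e.1).biUnion (fun T =>
          ({f : {e : Finset (Fin n) // #e = r} | T ⊆ f.1} : Finset _).image (fun f => (e, f)))) := by
      rintro ⟨e, f⟩ hx
      simp only [mem_filter, mem_univ, true_and] at hx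
      obtain ⟨T, hT, hTc⟩ := Finset.exists_subset_card_eq hx
      simp only [mem_biUnion, mem_univ, true_and, mem_image, mem_filter, mem_powersetCard]
      exact ⟨e, T, ⟨hT.trans inter_subset_left, hTc⟩, f, hT.trans inter_subset_right, rfl⟩
    refine (card_le_card hsub).trans ?_
    refine (card_biUnion_le_card_mul _ _ (r.choose 2 * (n - 2).choose (r - 2)) ?_).trans ?_
    · intro e _
      refine (card_biUnion_le_card_mul _ _ ((n - 2).choose (r - 2)) ?_).trans ?_
      · intro T hT
        exact card_image_le.trans (aux_superset T (mem_powersetCard.1 hT).2)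
      · rw [card_powersetCard, e.2]
    · rw [card_univ, Fintype.card_finset_len, Fintype.card_fin]
  calc _ ≤ n.choose r * (r.choose 2 * (n - 2).choose (r - 2)) * n.choose 2 :=
        Nat.mul_le_mul_right _ h1
    _ = n.choose r * r.choose 2 * (n.choose 2 * (n - 2).choose (r - 2)) := by ring
    _ = _ := by rw [← hch]; ring

open Finset in
theorem aux_P {n r : ℕ} (S : Finset (Fin n)) :
    (#S).choose r ≤ #{e : {e : Finset (Fin n) // #e = r} | e.1 ⊆ S} := by
  rw [← card_powersetCard]
  rw [← Finset.card_image_of_injective (f := Subtype.val) _ Subtype.val_injective]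
  apply card_le_card
  intro e he
  rw [mem_powersetCard] at he
  simp [he.1, he.2]

theorem aux_choose_ratio {m n r : ℕ} (hm : 2 * r ≤ m) (hn : 0 < n) :
    ((m : ℝ) / (2 * n)) ^ r * (n.choose r : ℝ) ≤ (m.choose r : ℝ) := by
  have h1 : (m + 1 - r) ^ r ≤ m.descFactorial r := Nat.pow_sub_le_descFactorial m r
  have h2 : n.descFactorial r ≤ n ^ r := Nat.descFactorial_le_pow n r
  rw [Nat.descFactorial_eq_factorial_mul_choose] at h1 h2
  have h1' : ((m + 1 - r : ℕ) : ℝ) ^ r ≤ (r.factorial : ℝ) * m.choose r := by exact_mod_cast h1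
  have h2' : (r.factorial : ℝ) * n.choose r ≤ (n : ℝ) ^ r := by exact_mod_cast h2
  have h3 : (m : ℝ) / 2 ≤ ((m + 1 - r : ℕ) : ℝ) := by
    rw [div_le_iff₀ (by norm_num)]
    have : m ≤ (m + 1 - r) * 2 := by omega
    exact_mod_cast this
  have hf : (0 : ℝ) < r.factorial := by exact_mod_cast Nat.factorial_pos r
  have hn' : (0 : ℝ) < n := by exact_mod_cast hn
  have h4 : ((m : ℝ) / 2) ^ r ≤ (r.factorial : ℝ) * m.choose r :=
    (pow_le_pow_left₀ (by positivity) h3 r).trans h1'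
  have h5 : ((m : ℝ) / (2 * n)) ^ r = ((m : ℝ) / 2) ^ r / (n : ℝ) ^ r := by
    rw [← div_pow]; congr 1; field_simp
  rw [h5, div_mul_eq_mul_div, div_le_iff₀ (by positivity)]
  have h6 : ((m : ℝ) / 2) ^ r * ((r.factorial : ℝ) * n.choose r) ≤
      ((r.factorial : ℝ) * m.choose r) * (n : ℝ) ^ r :=
    mul_le_mul h4 h2' (by positivity) (by positivity)
  refine le_of_mul_le_mul_left ?_ hf
  linarith

open Finset Classical in
theorem aux_design {n r m M t : ℕ} (b p : ℝ) (hr : 2 ≤ r) (hn : r ≤ n) (hm : 2 * r ≤ m)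
    (hb : 0 < b) (hbt : 2 * b ≤ t) (hp : p ≤ 1)
    (hM : (M : ℝ) ^ 2 * (r.choose 2 : ℝ) ^ 2 ≤ b * (n.choose 2 : ℝ))
    (hpm : p ≤ ((m : ℝ) / (2 * n)) ^ r)
    (hI : (2 : ℝ) ^ n * 2 ^ t * (1 - p / 2) ^ M < 1 / 2) :
    ∃ H : Finset (Finset (Fin n)), IsDesign r 2 H ∧
      ∀ S : Finset (Fin n), (∀ e ∈ H, ¬ e ⊆ S) → #S < m := by
  have hcardE : Fintype.card {e : Finset (Fin n) // #e = r} = n.choose r := by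
    rw [Fintype.card_finset_len, Fintype.card_fin]
  have : Nonempty {e : Finset (Fin n) // #e = r} := by
    rw [← Fintype.card_pos_iff, hcardE]; exact Nat.choose_pos hn
  have hc2 : (0 : ℝ) < n.choose 2 := by exact_mod_cast Nat.choose_pos (hr.trans hn)
  obtain ⟨f, hf1, hf2⟩ := aux_random (E := {e : Finset (Fin n) // #e = r})
    (I := {S : Finset (Fin n) // m ≤ #S}) M t b p hb (fun e f => 2 ≤ #(e.1 ∩ f.1))
    (fun S e => e.1 ⊆ S.1) (by
      rw [hcardE]
      have h := aux_R (n := n) (r := r) hr hn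
      have h' : (#{x : {e : Finset (Fin n) // #e = r} × {e : Finset (Fin n) // #e = r} |
        2 ≤ #(x.1.1 ∩ x.2.1)} : ℝ) * n.choose 2 ≤ (r.choose 2 : ℝ) ^ 2 * (n.choose r : ℝ) ^ 2 := by
        exact_mod_cast h
      refine le_of_mul_le_mul_right ?_ hc2
      have h3 := mul_le_mul_of_nonneg_left h' (sq_nonneg (M : ℝ))
      have h4 := mul_le_mul_of_nonneg_right hM (sq_nonneg (n.choose r : ℝ))
      calc _ ≤ (M : ℝ) ^ 2 * ((r.choose 2 : ℝ) ^ 2 * (n.choose r : ℝ) ^ 2) := by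
            rw [mul_assoc]; refine le_trans (le_of_eq ?_) h3; congr!
        _ ≤ _ := by linarith) hp (by
      intro S
      rw [hcardE]
      have h1 := aux_P (r := r) S.1
      have h2 := Nat.choose_le_choose r S.2
      have h3 : (m.choose r : ℝ) ≤ (#{e : {e : Finset (Fin n) // #e = r} | e.1 ⊆ S.1} : ℝ) := by
        exact_mod_cast h2.trans h1
      have h4 := aux_choose_ratio (m := m) (n := n) (r := r) hm (by omega)
      have h5 : p * (n.choose r : ℝ) ≤ ((m : ℝ) / (2 * n)) ^ r * (n.choose r : ℝ) :=
        mul_le_mul_of_nonneg_right hpm (by positivity)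
      refine (h5.trans (h4.trans h3)).trans (le_of_eq ?_)
      congr!) (by
      refine lt_of_le_of_lt ?_ hI
      have : (Fintype.card {S : Finset (Fin n) // m ≤ #S} : ℝ) ≤ 2 ^ n := by
        have := Fintype.card_subtype_le (fun S : Finset (Fin n) => m ≤ #S)
        rw [Fintype.card_finset, Fintype.card_fin] at this
        exact_mod_cast this
      have h0 : (0 : ℝ) ≤ 1 - p / 2 := by linarith
      gcongr)
  let good : Fin M → Prop := fun i => ∀ j, i ≠ j → ¬ 2 ≤ #((f i).1 ∩ (f j).1)
  refine ⟨({i | good i} : Finset (Fin M)).image (fun i => (f i).1), ⟨?_, ?_⟩, ?_⟩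
  · intro e he
    obtain ⟨i, -, rfl⟩ := mem_image.1 he
    exact (f i).2
  · intro e he e' he' hne
    obtain ⟨i, hi, rfl⟩ := mem_image.1 he
    obtain ⟨j, hj, rfl⟩ := mem_image.1 he'
    have hi : good i := (mem_filter.1 hi).2
    have hij : i ≠ j := by rintro rfl; exact hne rfl
    exact not_le.1 (hi j hij)
  · intro S hS
    by_contra hcon
    push Not at hcon
    have h1 := hf2 ⟨S, hcon⟩
    have hbad : ∀ i, (f i).1 ⊆ S → ∃ j, i ≠ j ∧ 2 ≤ #((f i).1 ∩ (f j).1) := by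
      intro i hi
      by_contra hc
      push Not at hc
      refine hS (f i).1 (mem_image.2 ⟨i, ?_, rfl⟩) hi
      simp only [mem_filter, mem_univ, true_and]
      intro j hj
      exact not_le.2 (hc j hj)
    have hsub : ({i | (f i).1 ⊆ S} : Finset (Fin M)) ⊆
        ({x : Fin M × Fin M | x.1 ≠ x.2 ∧ 2 ≤ #((f x.1).1 ∩ (f x.2).1)} : Finset _).image Prod.fst := by
      intro i hi
      obtain ⟨j, hj, hj2⟩ := hbad i (mem_filter.1 hi).2
      exact mem_image.2 ⟨(i, j), by simp only [mem_filter, mem_univ, true_and]; exact ⟨hj, hj2⟩, rfl⟩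
    have h2 := (card_le_card hsub).trans card_image_le
    have h3 : (#{x : Fin M × Fin M | x.1 ≠ x.2 ∧ 2 ≤ #((f x.1).1 ∩ (f x.2).1)} : ℝ) ≤ t := by
      refine le_trans (le_of_eq ?_) (hf1.trans hbt)
      congr!
    have h4 : #{x : Fin M × Fin M | x.1 ≠ x.2 ∧ 2 ≤ #((f x.1).1 ∩ (f x.2).1)} ≤ t := by exact_mod_cast h3
    refine absurd (h1.trans_le (le_trans (le_of_eq ?_) (h2.trans h4))) (lt_irrefl _)
    congr!

open Filter in
theorem aux_eventually : ∃ n₀ : ℕ, ∀ n : ℕ, n₀ ≤ n →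
    (100 ≤ n ∧ (12 : ℝ) ≤ (n : ℝ) ^ (0.973 : ℝ) ∧
      (1802 * 128 : ℝ) ≤ (n : ℝ) ^ (-0.162 : ℝ) * (Nat.sqrt n : ℝ)) := by
  have t1 : Tendsto (fun n : ℕ => (n : ℝ) ^ (0.973 : ℝ)) atTop atTop :=
    (tendsto_rpow_atTop (by norm_num)).comp tendsto_natCast_atTop_atTop
  have t2 : Tendsto (fun n : ℕ => (n : ℝ) ^ (0.338 : ℝ)) atTop atTop :=
    (tendsto_rpow_atTop (by norm_num)).comp tendsto_natCast_atTop_atTop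
  rw [← eventually_atTop]
  filter_upwards [t1.eventually_ge_atTop 12, t2.eventually_ge_atTop (1802 * 128 * 2),
    eventually_ge_atTop 100] with n h1 h2 h3
  refine ⟨h3, h1, ?_⟩
  have hn : (0 : ℝ) < n := by exact_mod_cast (by omega : 0 < n)
  have h4 : (n : ℝ) ^ (0.5 : ℝ) ≤ 2 * (Nat.sqrt n : ℝ) := by
    have ha : (n : ℝ) ≤ (2 * (Nat.sqrt n : ℝ)) ^ 2 := by
      have h5 : n < (Nat.sqrt n + 1) * (Nat.sqrt n + 1) := Nat.lt_succ_sqrt n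
      have h6 : 1 ≤ Nat.sqrt n := Nat.le_sqrt.2 (by omega)
      have h7 : n ≤ (2 * Nat.sqrt n) ^ 2 := by nlinarith
      exact_mod_cast h7
    have hb : (n : ℝ) ^ (0.5 : ℝ) = Real.sqrt n := by
      rw [Real.sqrt_eq_rpow]; norm_num
    rw [hb]
    exact Real.sqrt_le_iff.2 ⟨by positivity, ha⟩
  have h5 : (n : ℝ) ^ (0.338 : ℝ) = (n : ℝ) ^ (-0.162 : ℝ) * (n : ℝ) ^ (0.5 : ℝ) := by
    rw [← Real.rpow_add hn]; norm_num
  have h6 : (0 : ℝ) < (n : ℝ) ^ (-0.162 : ℝ) := Real.rpow_pos_of_pos hn _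
  rw [h5] at h2
  have := mul_le_mul_of_nonneg_left h4 h6.le
  linarith

theorem aux_large {n r : ℕ} (hr : 4 ≤ r) (hr6 : r ≤ 6) (h100 : 100 ≤ n)
    (h12 : (12 : ℝ) ≤ (n : ℝ) ^ (0.973 : ℝ))
    (hbig : (1802 * 128 : ℝ) ≤ (n : ℝ) ^ (-0.162 : ℝ) * (Nat.sqrt n : ℝ)) :
    ∃ H : Finset (Finset (Fin n)), IsDesign r 2 H ∧
      ∀ S : Finset (Fin n), (∀ e ∈ H, ¬ e ⊆ S) → S.card < ⌈(n : ℝ) ^ (0.973 : ℝ)⌉₊ := by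
  have hn : (0 : ℝ) < n := by exact_mod_cast (by omega : 0 < n)
  have hn1 : (1 : ℝ) ≤ n := by exact_mod_cast (by omega : 1 ≤ n)
  have hn100 : (100 : ℝ) ≤ n := by exact_mod_cast h100
  set m := ⌈(n : ℝ) ^ (0.973 : ℝ)⌉₊ with hmdef
  have hm : (n : ℝ) ^ (0.973 : ℝ) ≤ m := Nat.le_ceil _
  have hm12 : 12 ≤ m := by exact_mod_cast h12.trans hm
  have hmn : m ≤ n := by
    apply Nat.ceil_le.2
    calc (n : ℝ) ^ (0.973 : ℝ) ≤ (n : ℝ) ^ (1 : ℝ) :=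
          Real.rpow_le_rpow_of_exponent_le hn1 (by norm_num)
      _ = n := Real.rpow_one _
  have hmn' : (m : ℝ) ≤ n := by exact_mod_cast hmn
  have hple : (n : ℝ) ^ (-0.162 : ℝ) ≤ 1 := Real.rpow_le_one_of_one_le_of_nonpos hn1 (by norm_num)
  have hppos : (0 : ℝ) < (n : ℝ) ^ (-0.162 : ℝ) := Real.rpow_pos_of_pos hn _
  refine aux_design (M := n * Nat.sqrt n) (t := 1800 * n) (900 * n) ((n : ℝ) ^ (-0.162 : ℝ) / 64)
    (by omega) (by omega) (by omega) (by positivity) (by push_cast; linarith) (by linarith) ?_ ?_ ?_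
  · have h1 : ((Nat.sqrt n : ℕ) : ℝ) ^ 2 ≤ n := by exact_mod_cast Nat.sqrt_le' n
    have h2 : (r.choose 2 : ℝ) ^ 2 ≤ 225 := by
      have : r.choose 2 ≤ 15 := by interval_cases r <;> decide
      have : (r.choose 2 : ℝ) ≤ 15 := by exact_mod_cast this
      nlinarith [(Nat.cast_nonneg (r.choose 2) : (0 : ℝ) ≤ _)]
    rw [Nat.cast_choose_two ℝ n]
    push_cast
    calc ((n : ℝ) * Nat.sqrt n) ^ 2 * (r.choose 2 : ℝ) ^ 2
        ≤ ((n : ℝ) ^ 2 * n) * 225 := by rw [mul_pow]; gcongr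
      _ ≤ 900 * (n : ℝ) * ((n : ℝ) * ((n : ℝ) - 1) / 2) := by
          nlinarith [mul_pos hn hn, mul_nonneg (mul_pos hn hn).le (sub_nonneg.2 hn100)]
  · have hx : (n : ℝ) ^ (-0.027 : ℝ) / 2 ≤ (m : ℝ) / (2 * n) := by
      have : (n : ℝ) ^ (-0.027 : ℝ) = (n : ℝ) ^ (0.973 : ℝ) / n := by
        rw [eq_div_iff hn.ne', ← Real.rpow_add_one hn.ne']; norm_num
      rw [this, div_div, mul_comm (n : ℝ) 2]
      gcongr
    have h0 : (0 : ℝ) ≤ (n : ℝ) ^ (-0.027 : ℝ) / 2 := by positivity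
    have h6 : (n : ℝ) ^ (-0.162 : ℝ) / 64 = ((n : ℝ) ^ (-0.027 : ℝ) / 2) ^ 6 := by
      rw [div_pow, ← Real.rpow_natCast, ← Real.rpow_mul hn.le]; norm_num
    rw [h6]
    have hle1 : (m : ℝ) / (2 * n) ≤ 1 := by
      rw [div_le_one (by positivity)]; linarith
    exact (pow_le_pow_left₀ h0 hx 6).trans (pow_le_pow_of_le_one (by positivity) hle1 hr6)
  · set q : ℝ := (n : ℝ) ^ (-0.162 : ℝ) with hq
    have e1 : (1 - q / 64 / 2) ^ (n * Nat.sqrt n) ≤ Real.exp (-(q / 128) * (n * Nat.sqrt n)) := by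
      have h1 : 1 - q / 64 / 2 ≤ Real.exp (-(q / 128)) := by
        have := Real.add_one_le_exp (-(q / 128)); linarith
      calc _ ≤ (Real.exp (-(q / 128))) ^ (n * Nat.sqrt n) :=
            pow_le_pow_left₀ (by linarith) h1 _
        _ = _ := by rw [← Real.exp_nat_mul]; congr 1; push_cast; ring
    have e2 : (2 : ℝ) ^ n * 2 ^ (1800 * n) ≤ Real.exp (1801 * n) := by
      rw [← pow_add]
      have h2 : (2 : ℝ) ≤ Real.exp 1 := by have := Real.add_one_le_exp (1 : ℝ); linarith
      calc _ ≤ (Real.exp 1) ^ (n + 1800 * n) := pow_le_pow_left₀ (by norm_num) h2 _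
        _ = _ := by rw [← Real.exp_nat_mul]; congr 1; push_cast; ring
    have e3 : 1801 * (n : ℝ) + -(q / 128) * (n * Nat.sqrt n) ≤ -(n : ℝ) := by
      nlinarith [mul_le_mul_of_nonneg_left hbig hn.le]
    have e4 : Real.exp (-(n : ℝ)) < 1 / 2 := by
      rw [Real.exp_neg, inv_lt_comm₀ (Real.exp_pos _) (by norm_num)]
      have := Real.add_one_le_exp (n : ℝ)
      norm_num; linarith
    calc _ ≤ Real.exp (1801 * n) * Real.exp (-(q / 128) * (n * Nat.sqrt n)) := by
          apply mul_le_mul e2 e1 _ (Real.exp_pos _).le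
          apply pow_nonneg; linarith
      _ = Real.exp (1801 * (n : ℝ) + -(q / 128) * (n * Nat.sqrt n)) := by rw [Real.exp_add]
      _ ≤ Real.exp (-(n : ℝ)) := Real.exp_le_exp.2 e3
      _ < 1 / 2 := e4

theorem stmt0 :
    ∃ C : ℝ, 0 < C ∧ ∀ r ∈ ({4, 5, 6} : Set ℕ), ∀ n : ℕ, r ≤ n →
      ∃ H : Finset (Finset (Fin n)),
        IsDesign r 2 H ∧ IndepAtMost H (C * (n : ℝ) ^ (0.973 : ℝ)) := by
  obtain ⟨n₀, hn₀⟩ := aux_eventually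
  refine ⟨(n₀ : ℝ) + 1, by positivity, ?_⟩
  intro r hr n hrn
  have hr' : 4 ≤ r ∧ r ≤ 6 := by
    simp only [Set.mem_insert_iff, Set.mem_singleton_iff] at hr
    omega
  have hn1 : (1 : ℝ) ≤ n := by exact_mod_cast (by omega : 1 ≤ n)
  have hpow : (1 : ℝ) ≤ (n : ℝ) ^ (0.973 : ℝ) := Real.one_le_rpow hn1 (by norm_num)
  by_cases h : n₀ ≤ n
  · obtain ⟨h1, h2, h3⟩ := hn₀ n h
    obtain ⟨H, hH, hS⟩ := aux_large hr'.1 hr'.2 h1 h2 h3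
    refine ⟨H, hH, fun S hSe => ?_⟩
    have h4 := Nat.lt_ceil.1 (hS S hSe)
    have h5 : (0 : ℝ) ≤ n₀ := by positivity
    nlinarith
  · refine ⟨∅, ⟨by simp, by simp⟩, fun S _ => ?_⟩
    have h1 : S.card ≤ n₀ := by
      have := Finset.card_le_univ S
      rw [Fintype.card_fin] at this
      omega
    have h2 : (S.card : ℝ) ≤ n₀ := by exact_mod_cast h1
    have h5 : (0 : ℝ) ≤ n₀ := by positivity
    nlinarith
end

section
/- Let s = 3^{ℓ1} · 4^{ℓ2} · 5^{ℓ3} · 6^{ℓ4} + 1 where ℓ1, ℓ2, ℓ3, ℓ4 ≥ 0 are integers, and define R(s) = 3(s−1) if ℓ1 ≠ 0; R(s) = 4(s−1) if ℓ1 = 0 and ℓ2 ≠ 0; R(s) = 5(s−1) if ℓ1 = ℓ2 = 0 and ℓ3 ≠ 0; and R(s) = 6(s−1) if ℓ1 = ℓ2 = ℓ3 = 0. Then for every integer r with 2s ≤ r ≤ R(s) there exist constants C > 0 and ε > 0 (depending only on ℓ1, ℓ2, ℓ3, ℓ4) such that for every integer n ≥ r there exists an (n,r,s)-system with independence number at most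 C · n^{1−ε}. -/
open Finset in
/-- the number of `r`-sets meeting `f` in at least `s` points -/
lemma conflict_card {n r s : ℕ} (hsr : s ≤ r) (f : Finset (Fin n)) (hf : f.card = r) :
    ((powersetCard r (univ : Finset (Fin n))).filter (fun e => s ≤ (e ∩ f).card)).card
      ≤ 2 ^ r * n ^ (r - s) := by
  classical
  have hsub : (powersetCard r (univ : Finset (Fin n))).filter (fun e => s ≤ (e ∩ f).card) ⊆
      (powersetCard s f).biUnion
        (fun t => (powersetCard (r - s) (univ : Finset (Fin n))).image (fun u => t ∪ u)) := by
    intro e he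
    simp only [mem_filter, mem_powersetCard] at he
    obtain ⟨⟨-, hec⟩, hse⟩ := he
    obtain ⟨t, ht, htc⟩ := exists_subset_card_eq hse
    have hte : t ⊆ e := ht.trans inter_subset_left
    simp only [mem_biUnion, mem_image, mem_powersetCard]
    refine ⟨t, ⟨ht.trans inter_subset_right, htc⟩, e \ t, ⟨subset_univ _, ?_⟩, ?_⟩
    · rw [card_sdiff_of_subset hte, hec, htc]
    · exact union_sdiff_of_subset hte
  refine (card_le_card hsub).trans ?_
  refine (card_biUnion_le_card_mul _ _ (n ^ (r - s)) ?_).trans ?_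
  · intro t _
    refine card_image_le.trans ?_
    rw [card_powersetCard, card_univ, Fintype.card_fin]
    exact Nat.choose_le_pow _ _
  · rw [card_powersetCard, hf]
    exact Nat.mul_le_mul_right _ (Nat.choose_le_two_pow _ _)

open Finset in
/-- independent `m`-sets -/
def indepSets {n : ℕ} (m : ℕ) (H : Finset (Finset (Fin n))) : Finset (Finset (Fin n)) :=
  (powersetCard m univ).filter (fun S => ∀ e ∈ H, ¬ e ⊆ S)

set_option maxHeartbeats 2000000 in
open Finset in
lemma greedy_step {n r s m N : ℕ} (hsr : s ≤ r) (hn : 0 < n)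
    (h1 : 2 * (N * (2 ^ r * n ^ (r - s))) ≤ m.choose r)
    (H : Finset (Finset (Fin n))) (hH : IsDesign r s H) (hN : H.card ≤ N) :
    ∃ H' : Finset (Finset (Fin n)), IsDesign r s H' ∧ H'.card ≤ H.card + 1 ∧
      ((indepSets m H').card : ℝ) ≤
        (1 - (m.choose r : ℝ) / (2 * n ^ r)) * (indepSets m H).card := by
  classical
  set A := indepSets m H with hA
  by_cases hemp : A = ∅
  · refine ⟨H, hH, by omega, ?_⟩
    rw [← hA, hemp]; simp
  set G := (powersetCard r (univ : Finset (Fin n))).filter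
    (fun e => ∀ f ∈ H, (e ∩ f).card < s) with hG
  have hGc : (G.card : ℝ) ≤ (n : ℝ) ^ r := by
    have : G.card ≤ n ^ r := by
      refine (card_filter_le _ _).trans ?_
      rw [card_powersetCard, card_univ, Fintype.card_fin]
      exact Nat.choose_le_pow _ _
    exact_mod_cast this
  have hgood : ∀ S ∈ A, m.choose r ≤ 2 * (G.filter (fun e => e ⊆ S)).card := by
    intro S hS
    have hSm : S.card = m := by
      simp only [hA, indepSets, mem_filter, mem_powersetCard] at hS
      exact hS.1.2
    have hcov : powersetCard r S ⊆ G.filter (fun e => e ⊆ S) ∪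
        H.biUnion (fun f => (powersetCard r (univ : Finset (Fin n))).filter
          (fun e => s ≤ (e ∩ f).card)) := by
      intro e he
      rw [mem_powersetCard] at he
      by_cases hg : ∀ f ∈ H, (e ∩ f).card < s
      · apply mem_union_left
        simp only [hG, mem_filter, mem_powersetCard]
        exact ⟨⟨⟨subset_univ _, he.2⟩, hg⟩, he.1⟩
      · apply mem_union_right
        push Not at hg
        obtain ⟨f, hf, hfe⟩ := hg
        simp only [mem_biUnion, mem_filter, mem_powersetCard]
        exact ⟨f, hf, ⟨subset_univ _, he.2⟩, hfe⟩
    have h2 := (card_le_card hcov).trans (card_union_le _ _)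
    rw [card_powersetCard, hSm] at h2
    have h3 := card_biUnion_le_card_mul H (fun f => (powersetCard r (univ : Finset (Fin n))).filter
          (fun e => s ≤ (e ∩ f).card)) (2 ^ r * n ^ (r - s))
          (fun f hf => conflict_card hsr f (hH.1 f hf))
    have h4 : H.card * (2 ^ r * n ^ (r - s)) ≤ N * (2 ^ r * n ^ (r - s)) :=
      Nat.mul_le_mul_right _ hN
    omega
  have hdc : ∑ e ∈ G, (A.filter (fun S => e ⊆ S)).card
      = ∑ S ∈ A, (G.filter (fun e => e ⊆ S)).card :=
    sum_card_bipartiteAbove_eq_sum_card_bipartiteBelow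
      (fun (e S : Finset (Fin n)) => e ⊆ S)
  set β : ℝ := (m.choose r : ℝ) / (2 * n ^ r) with hβ
  have hnr : (0 : ℝ) < (n : ℝ) ^ r := by positivity
  have hβn : β * (n : ℝ) ^ r = (m.choose r : ℝ) / 2 := by rw [hβ]; field_simp
  have hβ0 : 0 ≤ β := by positivity
  have hApos : (0 : ℝ) < A.card := by
    exact_mod_cast card_pos.mpr (nonempty_iff_ne_empty.mpr hemp)
  by_cases hM : m.choose r = 0
  · refine ⟨H, hH, by omega, ?_⟩
    rw [← hA, hβ, hM]; simp
  have hex : ∃ e ∈ G, β * A.card ≤ ((A.filter (fun S => e ⊆ S)).card : ℝ) := by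
    have hGne : G.Nonempty := by
      obtain ⟨S, hS⟩ := nonempty_iff_ne_empty.mpr hemp
      have := hgood S hS
      have h5 : 0 < (G.filter (fun e => e ⊆ S)).card := by omega
      exact (card_pos.mp h5).mono (filter_subset _ _)
    apply exists_le_of_sum_le hGne
    rw [sum_const, nsmul_eq_mul]
    have h6 : (∑ e ∈ G, ((A.filter (fun S => e ⊆ S)).card : ℝ))
      = ∑ S ∈ A, ((G.filter (fun e => e ⊆ S)).card : ℝ) := by exact_mod_cast hdc
    rw [h6]
    have h7 : (A.card : ℝ) * ((m.choose r : ℝ) / 2) ≤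
        ∑ S ∈ A, ((G.filter (fun e => e ⊆ S)).card : ℝ) := by
      rw [← nsmul_eq_mul]
      apply card_nsmul_le_sum
      intro S hS
      have : (m.choose r : ℝ) ≤ 2 * ((G.filter (fun e => e ⊆ S)).card : ℝ) := by
        exact_mod_cast hgood S hS
      linarith
    refine le_trans ?_ h7
    rw [← hβn]
    have := mul_le_mul_of_nonneg_right hGc (mul_nonneg hβ0 hApos.le)
    linarith
  obtain ⟨e, he, hle⟩ := hex
  simp only [hG, mem_filter, mem_powersetCard] at he
  obtain ⟨⟨-, hec⟩, heg⟩ := he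
  refine ⟨insert e H, ⟨?_, ?_⟩, card_insert_le _ _, ?_⟩
  · intro f hf
    rcases mem_insert.mp hf with rfl | hf
    · exact hec
    · exact hH.1 f hf
  · intro f hf g hg hfg
    rcases mem_insert.mp hf with hf1 | hf1 <;> rcases mem_insert.mp hg with hg1 | hg1
    · exact absurd (hf1.trans hg1.symm) hfg
    · rw [hf1]; exact heg g hg1
    · rw [hg1, inter_comm]; exact heg f hf1
    · exact hH.2 f hf1 g hg1 hfg
  · have hsub : indepSets m (insert e H) ⊆ A.filter (fun S => ¬ e ⊆ S) := by
      intro S hS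
      simp only [hA, indepSets, mem_filter, mem_insert] at hS ⊢
      exact ⟨⟨hS.1, fun f hf => hS.2 f (Or.inr hf)⟩, hS.2 e (Or.inl rfl)⟩
    have h8 := card_le_card hsub
    have h9 := card_filter_add_card_filter_not (s := A) (fun S => e ⊆ S)
    have h8' : ((indepSets m (insert e H)).card : ℝ) ≤ (A.filter (fun S => ¬ e ⊆ S)).card := by
      exact_mod_cast h8
    have h9' : ((A.filter (fun S => e ⊆ S)).card : ℝ) + (A.filter (fun S => ¬ e ⊆ S)).card
      = A.card := by exact_mod_cast h9
    linarith

open Finset in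
lemma greedy_iter {n r s m N : ℕ} (hsr : s ≤ r) (hn : 0 < n)
    (h1 : 2 * (N * (2 ^ r * n ^ (r - s))) ≤ m.choose r) (k : ℕ) (hk : k ≤ N) :
    ∃ H : Finset (Finset (Fin n)), IsDesign r s H ∧ H.card ≤ k ∧
      ((indepSets m H).card : ℝ) ≤
        Real.exp (-(k * ((m.choose r : ℝ) / (2 * n ^ r)))) * 2 ^ n := by
  induction k with
  | zero =>
    refine ⟨∅, ⟨by simp, by simp⟩, by simp, ?_⟩
    have : (indepSets m (∅ : Finset (Finset (Fin n)))).card ≤ 2 ^ n := by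
      refine (card_le_univ _).trans ?_
      simp
    simp only [Nat.cast_zero, zero_mul, neg_zero, Real.exp_zero, one_mul]
    exact_mod_cast this
  | succ k ih =>
    obtain ⟨H, hH, hc, hb⟩ := ih (by omega)
    obtain ⟨H', hH', hc', hb'⟩ := greedy_step hsr hn h1 H hH (by omega)
    refine ⟨H', hH', by omega, hb'.trans ?_⟩
    set β : ℝ := (m.choose r : ℝ) / (2 * n ^ r)
    have h2 : 1 - β ≤ Real.exp (-β) := by
      have := Real.add_one_le_exp (-β); linarith
    calc (1 - β) * ((indepSets m H).card : ℝ)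
        ≤ Real.exp (-β) * ((indepSets m H).card : ℝ) := by gcongr
      _ ≤ Real.exp (-β) * (Real.exp (-(k * β)) * 2 ^ n) := by gcongr
      _ = Real.exp (-((k + 1 : ℕ) * β)) * 2 ^ n := by
        rw [← mul_assoc, ← Real.exp_add]; congr 2; push_cast; ring

open Finset in
lemma greedy_main {n r s m : ℕ} (hs : 1 ≤ s) (hsr : s ≤ r) (hn : 0 < n)
    (hM : 4 ^ (r + 3) * n ^ (2 * r - s + 1) ≤ (m.choose r) ^ 2) :
    ∃ H : Finset (Finset (Fin n)), IsDesign r s H ∧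
      ∀ S : Finset (Fin n), (∀ e ∈ H, ¬ e ⊆ S) → S.card < m := by
  set M := m.choose r with hMdef
  set B := 2 * (2 ^ r * n ^ (r - s)) with hB
  have hBpos : 0 < B := by positivity
  have hBM : B ≤ M := by
    refine (Nat.pow_le_pow_iff_left two_ne_zero).mp (le_trans ?_ hM)
    have e1 : B ^ 2 = 4 ^ (r + 1) * n ^ (2 * (r - s)) := by
      have h4 : (4 : ℕ) ^ (r + 1) = 2 ^ (2 * (r + 1)) := by rw [pow_mul]; norm_num
      rw [hB, h4]; ring
    rw [e1]
    exact Nat.mul_le_mul (Nat.pow_le_pow_right (by norm_num) (by omega))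
      (Nat.pow_le_pow_right hn (by omega))
  set N := M / B with hNdef
  have hN1 : N * B ≤ M := Nat.div_mul_le_self _ _
  have hN2 : M ≤ 2 * (N * B) := by
    have h := Nat.div_add_mod M B
    have h' := Nat.mod_lt M hBpos
    have h3 : 1 ≤ N := (Nat.one_le_div_iff hBpos).mpr hBM
    have h4 : B ≤ N * B := Nat.le_mul_of_pos_left _ h3
    have h5 : B * N = N * B := mul_comm _ _
    rw [← hNdef] at h
    omega
  obtain ⟨H, hH, -, hb⟩ := greedy_iter (m := m) (N := N) hsr hn
    (by rw [← hMdef]; refine le_trans (le_of_eq ?_) hN1; rw [hB]; ring) N le_rfl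
  refine ⟨H, hH, fun S hS => ?_⟩
  -- key numeric inequality
  have hkey : 2 * n ^ (r + 1) ≤ N * M := by
    have e1 : n ^ (r + 1) * n ^ (r - s) = n ^ (2 * r - s + 1) := by
      rw [← pow_add]; congr 1; omega
    have h1 : M * M ≤ 2 * (N * B) * M := Nat.mul_le_mul_right _ hN2
    have h2 : (2 * n ^ (r + 1)) * (2 * B) ≤ (N * M) * (2 * B) := by
      calc (2 * n ^ (r + 1)) * (2 * B) = 8 * 2 ^ r * (n ^ (r + 1) * n ^ (r - s)) := by
            rw [hB]; ring
        _ = 8 * 2 ^ r * n ^ (2 * r - s + 1) := by rw [e1]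
        _ ≤ 4 ^ (r + 3) * n ^ (2 * r - s + 1) := by
            apply Nat.mul_le_mul_right
            have : 2 ^ r ≤ 4 ^ r := Nat.pow_le_pow_left (by norm_num) r
            rw [pow_add]; omega
        _ ≤ M ^ 2 := hM
        _ ≤ 2 * (N * B) * M := by rw [pow_two]; exact h1
        _ = (N * M) * (2 * B) := by ring
    exact Nat.le_of_mul_le_mul_right h2 (by positivity)
  have hkey' : (n : ℝ) ≤ N * ((M : ℝ) / (2 * n ^ r)) := by
    have h0 : (2 : ℝ) * n ^ (r + 1) ≤ N * M := by exact_mod_cast hkey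
    have hnr : (0 : ℝ) < 2 * (n : ℝ) ^ r := by positivity
    rw [← mul_div_assoc, le_div_iff₀ hnr]
    calc (n : ℝ) * (2 * n ^ r) = 2 * n ^ (r + 1) := by ring
      _ ≤ _ := h0
  have hlt : ((indepSets m H).card : ℝ) < 1 := by
    refine hb.trans_lt ?_
    calc Real.exp (-(N * ((M : ℝ) / (2 * n ^ r)))) * 2 ^ n
        ≤ Real.exp (-(n : ℝ)) * 2 ^ n := by gcongr
      _ < Real.exp (-(n : ℝ)) * (Real.exp 1) ^ n := by
          have : (2 : ℝ) < Real.exp 1 := by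
            have := Real.exp_one_gt_d9; linarith
          gcongr
      _ = 1 := by
          rw [← Real.exp_nat_mul, ← Real.exp_add]; simp
  have hz : (indepSets m H) = ∅ := by
    have : (indepSets m H).card < 1 := by exact_mod_cast hlt
    exact card_eq_zero.mp (by omega)
  by_contra hcon
  push Not at hcon
  obtain ⟨T, hT, hTc⟩ := exists_subset_card_eq hcon
  have : T ∈ indepSets m H := by
    simp only [indepSets, mem_filter, mem_powersetCard]
    exact ⟨⟨subset_univ _, hTc⟩, fun e he h => hS e he (h.trans hT)⟩
  rw [hz] at this
  simp at this

lemma design_exists {n r s R : ℕ} (hs : 2 ≤ s) (hsr : s ≤ r) (hrR : r ≤ R) (hn : 0 < n) :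
    ∃ H : Finset (Finset (Fin n)), IsDesign r s H ∧
      IndepAtMost H ((32 * R + 1) * (n : ℝ) ^ ((1 : ℝ) - 1 / (2 * R))) := by
  have hr : 2 ≤ r := by omega
  have hRpos : (0 : ℝ) < R := by exact_mod_cast (by omega : 0 < R)
  set x : ℝ := (n : ℝ) ^ ((1 : ℝ) - 1 / (2 * R)) with hx
  have hn1 : (1 : ℝ) ≤ n := by exact_mod_cast hn
  have hR1 : (1 : ℝ) ≤ R := by exact_mod_cast (by omega : 1 ≤ R)
  have hx1 : 1 ≤ x := by
    apply Real.one_le_rpow hn1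
    rw [sub_nonneg, div_le_one (by positivity)]; linarith
  set m := ⌈32 * R * x⌉₊ with hm
  have hm1 : 32 * R * x ≤ m := Nat.le_ceil _
  have hm2 : (m : ℝ) < 32 * R * x + 1 := Nat.ceil_lt_add_one (by positivity)
  have hrR' : (r : ℝ) ≤ R := by exact_mod_cast hrR
  have hr0 : (0 : ℝ) < r := by exact_mod_cast (by omega : 0 < r)
  have hmr : 2 * r ≤ m := by
    have : (2 : ℝ) * r ≤ m := by nlinarith
    exact_mod_cast this
  have hch : (16 * x) ^ r ≤ (m.choose r : ℝ) := by
    have h1 : (m + 1 - r) ^ r ≤ r.factorial * m.choose r := by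
      rw [← Nat.descFactorial_eq_factorial_mul_choose]; exact Nat.pow_sub_le_descFactorial m r
    have h2 : r.factorial ≤ r ^ r := Nat.factorial_le_pow r
    have h3 : (((m + 1 - r : ℕ)) : ℝ) ^ r ≤ (r : ℝ) ^ r * m.choose r := by
      exact_mod_cast h1.trans (Nat.mul_le_mul_right _ h2)
    have h4 : (r : ℝ) * (16 * x) ≤ ((m + 1 - r : ℕ) : ℝ) := by
      have h5 : (m : ℝ) ≤ 2 * ((m + 1 - r : ℕ) : ℝ) := by
        exact_mod_cast (by omega : m ≤ 2 * (m + 1 - r))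
      nlinarith
    have h6 : (r : ℝ) ^ r * (16 * x) ^ r ≤ (r : ℝ) ^ r * m.choose r := by
      rw [← mul_pow]
      exact (pow_le_pow_left₀ (by positivity) h4 r).trans h3
    exact le_of_mul_le_mul_left h6 (by positivity)
  have hxp : (n : ℝ) ^ (2 * r - s + 1) ≤ x ^ (2 * r) := by
    rw [hx, ← Real.rpow_natCast, ← Real.rpow_natCast, ← Real.rpow_mul (by positivity)]
    apply Real.rpow_le_rpow_of_exponent_le hn1
    have h1 : ((2 * r - s + 1 : ℕ) : ℝ) ≤ 2 * r - 1 := by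
      have : (2 * r - s + 1 : ℕ) + 1 ≤ 2 * r := by omega
      have : (((2 * r - s + 1 : ℕ) : ℝ)) + 1 ≤ 2 * r := by exact_mod_cast this
      linarith
    refine h1.trans ?_
    have h2 : (r : ℝ) / R ≤ 1 := (div_le_one hRpos).mpr hrR'
    have h3 : (1 - 1 / (2 * (R : ℝ))) * ((2 * r : ℕ) : ℝ) = 2 * r - r / R := by
      push_cast; field_simp
    rw [h3]; linarith
  have hM : 4 ^ (r + 3) * n ^ (2 * r - s + 1) ≤ (m.choose r) ^ 2 := by
    have h1 : (4 : ℝ) ^ (r + 3) * n ^ (2 * r - s + 1) ≤ (m.choose r : ℝ) ^ 2 := by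
      calc (4 : ℝ) ^ (r + 3) * n ^ (2 * r - s + 1) ≤ 4 ^ (4 * r) * x ^ (2 * r) := by
            gcongr
            · norm_num
            · omega
        _ = ((16 * x) ^ r) ^ 2 := by
            rw [mul_pow, mul_pow, ← pow_mul, ← pow_mul, show (16 : ℝ) = 4 ^ 2 by norm_num,
              ← pow_mul]
            ring_nf
        _ ≤ _ := by gcongr
    exact_mod_cast h1
  obtain ⟨H, hH, hI⟩ := greedy_main (by omega) hsr hn hM
  refine ⟨H, hH, fun S hS => ?_⟩
  have h1 : (S.card : ℝ) ≤ m := by exact_mod_cast (hI S hS).le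
  linarith

theorem stmt1 (ℓ1 ℓ2 ℓ3 ℓ4 : ℕ) :
    ∀ s : ℕ, s = 3 ^ ℓ1 * 4 ^ ℓ2 * 5 ^ ℓ3 * 6 ^ ℓ4 + 1 →
    ∀ R : ℕ, R = (if ℓ1 ≠ 0 then 3 * (s - 1) else if ℓ2 ≠ 0 then 4 * (s - 1)
        else if ℓ3 ≠ 0 then 5 * (s - 1) else 6 * (s - 1)) →
    ∃ C ε : ℝ, 0 < C ∧ 0 < ε ∧
      ∀ r : ℕ, 2 * s ≤ r → r ≤ R → ∀ n : ℕ, r ≤ n →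
        ∃ H : Finset (Finset (Fin n)),
          IsDesign r s H ∧ IndepAtMost H (C * (n : ℝ) ^ ((1 : ℝ) - ε)) := by
  intro s hs R hR
  have hp : 0 < 3 ^ ℓ1 * 4 ^ ℓ2 * 5 ^ ℓ3 * 6 ^ ℓ4 := by positivity
  have hs2 : 2 ≤ s := by omega
  have hRpos : 0 < R := by
    rw [hR]; split_ifs <;> omega
  have hRpos' : (0 : ℝ) < R := by exact_mod_cast hRpos
  refine ⟨32 * R + 1, 1 / (2 * R), by positivity, by positivity, ?_⟩
  intro r hr hrR n hn
  exact design_exists hs2 (by omega) hrR (by omega)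
end

section
/- Suppose that H₁ is an (n₁,r₁,s₁)-system and H₂ is an (n₂,r₂,s₂)-system. Then the direct product H₁ □ H₂ is an (n₁n₂, r₁r₂, max{r₁(s₂−1)+1, r₂(s₁−1)+1})-system; in particular, every pair of distinct edges of H₁ □ H₂ intersects in at most max{r₁(s₂−1), r₂(s₁−1)} vertices. -/
/-- The direct product of two hypergraphs: its edges are exactly the cartesian products
`E₁ ×ˢ E₂` of an edge `E₁` of `H₁` and an edge `E₂` of `H₂`. -/
def DirectProd {V₁ V₂ : Type*} [DecidableEq V₁] [DecidableEq V₂]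
    (H₁ : Finset (Finset V₁)) (H₂ : Finset (Finset V₂)) : Finset (Finset (V₁ × V₂)) :=
  Finset.image₂ (fun E₁ E₂ => E₁ ×ˢ E₂) H₁ H₂

theorem stmt5 (n₁ n₂ r₁ r₂ s₁ s₂ : ℕ) (hs₁ : 1 ≤ s₁) (hs₂ : 1 ≤ s₂)
    (H₁ : Finset (Finset (Fin n₁))) (H₂ : Finset (Finset (Fin n₂)))
    (h₁ : IsDesign r₁ s₁ H₁) (h₂ : IsDesign r₂ s₂ H₂) :
    Nat.card (Fin n₁ × Fin n₂) = n₁ * n₂ ∧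
    IsDesign (r₁ * r₂) (max (r₁ * (s₂ - 1) + 1) (r₂ * (s₁ - 1) + 1)) (DirectProd H₁ H₂) ∧
    (∀ e ∈ DirectProd H₁ H₂, ∀ f ∈ DirectProd H₁ H₂, e ≠ f →
      (e ∩ f).card ≤ max (r₁ * (s₂ - 1)) (r₂ * (s₁ - 1))) := by
  have key : ∀ e ∈ DirectProd H₁ H₂, ∀ f ∈ DirectProd H₁ H₂, e ≠ f →
      (e ∩ f).card ≤ max (r₁ * (s₂ - 1)) (r₂ * (s₁ - 1)) := by
    intro e he f hf hne
    obtain ⟨a, ha, b, hb, rfl⟩ := Finset.mem_image₂.1 he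
    obtain ⟨c, hc, d, hd, rfl⟩ := Finset.mem_image₂.1 hf
    rw [Finset.product_inter_product, Finset.card_product]
    by_cases hac : a = c
    · have hbd : b ≠ d := by
        rintro rfl
        exact hne (by rw [hac])
      refine le_max_of_le_left (Nat.mul_le_mul ?_ ?_)
      · rw [← h₁.1 a ha]
        exact Finset.card_le_card Finset.inter_subset_left
      · have := h₂.2 b hb d hd hbd
        omega
    · refine le_max_of_le_right ?_
      rw [mul_comm]
      refine Nat.mul_le_mul ?_ ?_
      · rw [← h₂.1 b hb]
        exact Finset.card_le_card Finset.inter_subset_left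
      · have := h₁.2 a ha c hc hac
        omega
  refine ⟨by simp, ⟨?_, ?_⟩, key⟩
  · intro e he
    obtain ⟨a, ha, b, hb, rfl⟩ := Finset.mem_image₂.1 he
    rw [Finset.card_product, h₁.1 a ha, h₂.1 b hb]
  · intro e he f hf hne
    have := key e he f hf hne
    omega
end

section
/- (Dependent random choice, bipartite version.) Let a, m, n₁, n₂, r, t be positive integers and d₁ ≥ 0 a real number. Let G be a bipartite graph with parts V₁ and V₂, where |V₁| = n₁ and |V₂| = n₂, and suppose G has at least d₁·n₁ edges. If n₁·d₁^t / n₂^t − C(n₁, r)·(m/n₂)^t ≥ a (where C(n₁,r) is the binomial coefficient), then there exists a subset U ⊆ V₁ with |U| ≥ a such that every r-element subset S of U has at least m common neighbors in V₂ (vertices adjacent to all elements of S). -/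
theorem stmt6_count (n t : ℕ) (N : Finset (Fin n)) :
    (Finset.univ.filter (fun T : Fin t → Fin n => ∀ i, T i ∈ N)).card = N.card ^ t := by
  have h : (Finset.univ.filter (fun T : Fin t → Fin n => ∀ i, T i ∈ N))
      = Fintype.piFinset (fun _ : Fin t => N) := by
    ext T; simp [Fintype.mem_piFinset]
  rw [h]; simp

theorem stmt6 (a m n₁ n₂ r t : ℕ) (ha : 0 < a) (hm : 0 < m) (hn₁ : 0 < n₁) (hn₂ : 0 < n₂)
    (hr : 0 < r) (ht : 0 < t) (d₁ : ℝ) (hd₁ : 0 ≤ d₁)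
    (G : Finset (Fin n₁ × Fin n₂)) (hG : d₁ * (n₁ : ℝ) ≤ (G.card : ℝ))
    (hineq : (a : ℝ) ≤ (n₁ : ℝ) * d₁ ^ t / (n₂ : ℝ) ^ t -
      (n₁.choose r : ℝ) * ((m : ℝ) / (n₂ : ℝ)) ^ t) :
    ∃ U : Finset (Fin n₁), (a : ℝ) ≤ (U.card : ℝ) ∧
      ∀ S ⊆ U, S.card = r →
        m ≤ (Finset.univ.filter (fun v : Fin n₂ => ∀ u ∈ S, (u, v) ∈ G)).card := by
  classical
  let N : Finset (Fin n₁) → Finset (Fin n₂) := fun S =>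
    Finset.univ.filter (fun v : Fin n₂ => ∀ u ∈ S, (u, v) ∈ G)
  let D : Fin n₁ → Finset (Fin n₂) := fun u => Finset.univ.filter (fun v => (u, v) ∈ G)
  let A : (Fin t → Fin n₂) → Finset (Fin n₁) := fun T =>
    Finset.univ.filter (fun u => ∀ i, (u, T i) ∈ G)
  let B : Finset (Finset (Fin n₁)) :=
    (Finset.powersetCard r Finset.univ).filter (fun S => (N S).card < m)
  have h1 : ∑ T, (A T).card = ∑ u, (D u).card ^ t := by
    simp only [A, Finset.card_filter (fun u => ∀ i, (u, _) ∈ G)]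
    rw [Finset.sum_comm]
    refine Finset.sum_congr rfl fun u _ => ?_
    rw [← stmt6_count, Finset.card_filter]
    simp [D]
  have h2 : ∑ T, (B.filter (fun S => S ⊆ A T)).card = ∑ S ∈ B, (N S).card ^ t := by
    simp only [Finset.card_filter (fun S => S ⊆ _)]
    rw [Finset.sum_comm]
    refine Finset.sum_congr rfl fun S _ => ?_
    rw [← stmt6_count, Finset.card_filter]
    refine Finset.sum_congr rfl fun T _ => ?_
    congr 1
    simp only [A, N, Finset.subset_iff, Finset.mem_filter, Finset.mem_univ, true_and, eq_iff_iff]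
    exact ⟨fun h i u hu => h hu i, fun h u hu i => h i u hu⟩
  have h3 : ∑ u, (D u).card = G.card := by
    simp only [D, Finset.card_filter]
    rw [← Fintype.sum_prod_type' (f := fun u v => if (u, v) ∈ G then 1 else 0)]
    simp
  have hn₁' : (0 : ℝ) < n₁ := by exact_mod_cast hn₁
  have hn₂' : (0 : ℝ) < n₂ := by exact_mod_cast hn₂
  have h4 : (n₁ : ℝ) * d₁ ^ t ≤ ∑ u, ((D u).card : ℝ) ^ t := by
    obtain ⟨k, rfl⟩ : ∃ k, t = k + 1 := ⟨t - 1, by omega⟩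
    have := pow_sum_div_card_le_sum_pow (s := (Finset.univ : Finset (Fin n₁)))
      (f := fun u => ((D u).card : ℝ)) (fun _ _ => by positivity) k
    refine le_trans ?_ this
    rw [← Nat.cast_sum, h3, Finset.card_univ, Fintype.card_fin, le_div_iff₀ (by positivity)]
    calc (n₁ : ℝ) * d₁ ^ (k+1) * n₁ ^ k = (d₁ * n₁) ^ (k+1) := by ring
      _ ≤ _ := by gcongr
  have h5 : ∑ S ∈ B, ((N S).card : ℝ) ^ t ≤ (n₁.choose r : ℝ) * (m : ℝ) ^ t := by
    have hB : B.card ≤ n₁.choose r := by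
      refine (Finset.card_filter_le _ _).trans ?_
      simp [Finset.card_powersetCard]
    calc ∑ S ∈ B, ((N S).card : ℝ) ^ t ≤ ∑ S ∈ B, (m : ℝ) ^ t := by
          refine Finset.sum_le_sum fun S hS => ?_
          have : (N S).card ≤ m := (Finset.mem_filter.1 hS).2.le
          gcongr
      _ = (B.card : ℝ) * (m : ℝ) ^ t := by simp
      _ ≤ _ := by gcongr
  have h6 : ∃ T, (a : ℝ) ≤ ((A T).card : ℝ) - ((B.filter (fun S => S ⊆ A T)).card : ℝ) := by
    by_contra! hcon
    have : Nonempty (Fin t → Fin n₂) := ⟨fun _ => ⟨0, hn₂⟩⟩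
    have hlt := Finset.sum_lt_sum_of_nonempty (s := (Finset.univ : Finset (Fin t → Fin n₂)))
      Finset.univ_nonempty (fun T _ => hcon T)
    rw [Finset.sum_sub_distrib, ← Nat.cast_sum, ← Nat.cast_sum, h1, h2] at hlt
    simp at hlt
    have e : (n₁ : ℝ) * d₁ ^ t / (n₂ : ℝ) ^ t - (n₁.choose r : ℝ) * ((m : ℝ) / (n₂ : ℝ)) ^ t
      = ((n₁ : ℝ) * d₁ ^ t - (n₁.choose r : ℝ) * (m : ℝ) ^ t) / (n₂ : ℝ) ^ t := by
      rw [div_pow]; ring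
    rw [e, le_div_iff₀ (by positivity)] at hineq
    linarith
  obtain ⟨T, hT⟩ := h6
  let p : Finset (Fin n₁) → Fin n₁ := fun S => if h : S.Nonempty then h.choose else ⟨0, hn₁⟩
  let I := (B.filter (fun S => S ⊆ A T)).image p
  refine ⟨A T \ I, ?_, ?_⟩
  · have c1 : (A T).card ≤ (A T \ I).card + I.card := by
      have := Finset.le_card_sdiff I (A T)
      omega
    have c2 : I.card ≤ (B.filter (fun S => S ⊆ A T)).card := Finset.card_image_le
    have c3 : ((A T).card : ℝ) ≤ (A T \ I).card + (B.filter (fun S => S ⊆ A T)).card := by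
      exact_mod_cast c1.trans (by omega)
    linarith
  · intro S hS hSr
    by_contra! hlt
    have hne : S.Nonempty := Finset.card_pos.1 (by omega)
    have hp : p S ∈ S := by
      simp only [p, dif_pos hne]; exact hne.choose_spec
    have hSB : S ∈ B := Finset.mem_filter.2
      ⟨Finset.mem_powersetCard.2 ⟨Finset.subset_univ _, hSr⟩, hlt⟩
    have hI : p S ∈ I := Finset.mem_image_of_mem p
      (Finset.mem_filter.2 ⟨hSB, hS.trans Finset.sdiff_subset⟩)
    exact (Finset.mem_sdiff.1 (hS hp)).2 hI
end

section
/- For every sufficiently large integer k, the independence number of A(6,k) satisfies α(A(6,k)) ≤ (5.709)^k; in particular, with n = 6^k, α(A(6,k)) ≤ n^{0.973}. -/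
/-- An edge of the hypergraph `A(r,k)`: an `r`-element subset of `(ℤ/rℤ)^k` of the form
`{a, a+d, a+2d, …, a+(r−1)d}` having exactly `r` distinct elements
(a nontrivial `r`-term arithmetic progression). -/
def APEdge (r k : ℕ) (E : Finset (Fin k → ZMod r)) : Prop :=
  E.card = r ∧ ∃ a d : Fin k → ZMod r, E = (Finset.range r).image (fun i => a + i • d)

namespace Cap6

def cf (p : Fin 3 × Fin 3 × Fin 3) : ZMod 3 :=
  if p = (0, 0, 0) then 1
  else if (p.1 : ℕ) + p.2.1 + p.2.2 = 2 then
    (if p.1 = 2 ∨ p.2.1 = 2 ∨ p.2.2 = 2 then -1 else 1)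
  else 0

theorem cf_ne (p) (h : cf p ≠ 0) : (p.1 : ℕ) + p.2.1 + p.2.2 ≤ 2 := by
  revert p; decide

set_option maxRecDepth 100000 in
theorem cf_expand : ∀ x y z : ZMod 3, 1 - (x + y + z) ^ 2 =
    ∑ p, cf p * (x ^ (p.1 : ℕ) * y ^ (p.2.1 : ℕ) * z ^ (p.2.2 : ℕ)) := by
  intro x y z
  simp only [Fintype.sum_prod_type, Fin.sum_univ_three]
  revert x y z
  decide

variable {ι : Type} [Fintype ι] [DecidableEq ι]

def mon (α : ι → Fin 3) (x : ι → ZMod 3) : ZMod 3 := ∏ i, x i ^ (α i : ℕ)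

def low (ι : Type) [Fintype ι] [DecidableEq ι] (m : ℕ) : Finset (ι → Fin 3) :=
  Finset.univ.filter (fun α => ∑ i, (α i : ℕ) ≤ m)

theorem tensor_expand (x y z : ι → ZMod 3) :
    (if x + y + z = 0 then (1 : ZMod 3) else 0) =
      ∑ f : ι → Fin 3 × Fin 3 × Fin 3, (∏ i, cf (f i)) *
        (mon (fun i => (f i).1) x * mon (fun i => (f i).2.1) y * mon (fun i => (f i).2.2) z) := by
  have h1 : (if x + y + z = 0 then (1 : ZMod 3) else 0) = ∏ i, (1 - (x i + y i + z i) ^ 2) := by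
    split_ifs with h
    · rw [Finset.prod_eq_one]
      intro i _
      have := congrFun h i
      simp only [Pi.add_apply, Pi.zero_apply] at this
      rw [this]; simp
    · obtain ⟨i, hi⟩ := Function.ne_iff.mp h
      symm
      apply Finset.prod_eq_zero (Finset.mem_univ i)
      simp only [Pi.add_apply, Pi.zero_apply] at hi
      generalize x i + y i + z i = w at hi
      revert w; decide
  rw [h1]
  simp_rw [cf_expand]
  rw [Finset.prod_univ_sum, Fintype.piFinset_univ]
  apply Finset.sum_congr rfl
  intro f _
  simp only [mon, Finset.prod_mul_distrib]

/-- a subspace contains a vector of large support -/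
theorem exists_support {T : Type} [Fintype T] [DecidableEq T] (K : Submodule (ZMod 3) (T → ZMod 3)) :
    ∃ h ∈ K, Module.finrank (ZMod 3) K ≤ (Finset.univ.filter (fun t => h t ≠ 0)).card := by
  have hfin : Set.Finite (K : Set (T → ZMod 3)) := Set.toFinite _
  obtain ⟨h, hK, hmax⟩ := Set.exists_max_image (K : Set (T → ZMod 3))
    (fun h => (Finset.univ.filter (fun t => h t ≠ 0)).card) hfin ⟨0, K.zero_mem⟩
  refine ⟨h, hK, ?_⟩
  by_contra! hlt
  set s := Finset.univ.filter (fun t => h t ≠ 0) with hs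
  let φ : K →ₗ[ZMod 3] (s → ZMod 3) :=
    (LinearMap.funLeft (ZMod 3) (ZMod 3) (fun t : s => (t : T))).comp K.subtype
  have hker : 0 < Module.finrank (ZMod 3) (LinearMap.ker φ) := by
    have := LinearMap.finrank_range_add_finrank_ker φ
    have h2 := Submodule.finrank_le (LinearMap.range φ)
    rw [Module.finrank_fintype_fun_eq_card, Fintype.card_coe] at h2
    omega
  have := Module.finrank_pos_iff.mp hker
  obtain ⟨v, hv⟩ := exists_ne (0 : LinearMap.ker φ)
  have hvz : ∀ t, h t ≠ 0 → (v : K).1 t = 0 := by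
    intro t ht
    have := v.2
    rw [LinearMap.mem_ker] at this
    have h3 := congrFun this ⟨t, by simp [hs, ht]⟩
    exact h3
  have hvne : ∃ t, (v : K).1 t ≠ 0 := by
    by_contra! hc
    apply hv
    ext t
    exact hc t
  obtain ⟨t0, ht0⟩ := hvne
  have h4 := hmax (h + (v : K).1) (K.add_mem hK (v : K).2)
  refine absurd h4 (not_le.mpr (Finset.card_lt_card ?_))
  rw [Finset.ssubset_iff_of_subset]
  · refine ⟨t0, ?_, ?_⟩
    · have : h t0 = 0 := by
        by_contra hc; exact ht0 (hvz t0 hc)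
      simp [this, ht0]
    · simp only [hs, Finset.mem_filter, Finset.mem_univ, true_and, not_not]
      by_contra hc; exact ht0 (hvz t0 hc)
  · intro t ht
    simp only [hs, Finset.mem_filter, Finset.mem_univ, true_and] at ht ⊢
    simp [hvz t ht, ht]

def ev (T : Finset (ι → ZMod 3)) (m : ℕ) : (T → ZMod 3) →ₗ[ZMod 3] (low ι m → ZMod 3) where
  toFun g := fun γ => ∑ z : T, g z * mon γ.1 z.1
  map_add' g g' := by ext γ; simp [add_mul, Finset.sum_add_distrib]
  map_smul' c g := by ext γ; simp [mul_assoc, Finset.mul_sum]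

theorem ev_ker (T : Finset (ι → ZMod 3)) (m : ℕ) :
    T.card ≤ Module.finrank (ZMod 3) (LinearMap.ker (ev T m)) + (low ι m).card := by
  have := LinearMap.finrank_range_add_finrank_ker (ev T m)
  have h2 := Submodule.finrank_le (LinearMap.range (ev T m))
  rw [Module.finrank_fintype_fun_eq_card, Fintype.card_coe] at h2
  rw [Module.finrank_fintype_fun_eq_card, Fintype.card_coe] at this
  omega

theorem key (e : ℕ) (hι : Fintype.card ι = 3 * e) (f : ι → Fin 3 × Fin 3 × Fin 3)
    (hf : ∏ i, cf (f i) ≠ 0) :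
    (fun i => (f i).1) ∈ low ι (2 * e) ∨ (fun i => (f i).2.1) ∈ low ι (2 * e) ∨
      (fun i => (f i).2.2) ∈ low ι (2 * e) := by
  have h1 : ∑ i, (((f i).1 : ℕ) + (f i).2.1 + (f i).2.2) ≤ ∑ i : ι, 2 := by
    apply Finset.sum_le_sum
    intro i _
    apply cf_ne
    exact (Finset.prod_ne_zero_iff.mp hf) i (Finset.mem_univ i)
  simp only [Finset.sum_add_distrib, Finset.sum_const, Finset.card_univ, hι, smul_eq_mul] at h1
  simp only [low, Finset.mem_filter, Finset.mem_univ, true_and]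
  omega

theorem cap_bound (e : ℕ) (hι : Fintype.card ι = 3 * e) (A : Finset (ι → ZMod 3))
    (hA : ∀ x ∈ A, ∀ y ∈ A, ∀ z ∈ A, x + y + z = 0 → x = y ∧ y = z) :
    A.card ≤ 3 * (low ι (2 * e)).card := by
  classical
  set m := 2 * e with hm
  obtain ⟨h, hK, hsupp⟩ := exists_support (LinearMap.ker (ev A m))
  have hA1 := ev_ker A m
  set T : Finset (ι → ZMod 3) :=
    (Finset.univ.filter (fun t : A => h t ≠ 0)).map (Function.Embedding.subtype _) with hT
  have hTA : ∀ t ∈ T, ∃ ht : t ∈ A, h ⟨t, ht⟩ ≠ 0 := by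
    intro t ht
    simp only [hT, Finset.mem_map, Finset.mem_filter, Finset.mem_univ, true_and] at ht
    obtain ⟨a, ha, rfl⟩ := ht
    exact ⟨a.2, ha⟩
  have hTc : T.card = (Finset.univ.filter (fun t : A => h t ≠ 0)).card := Finset.card_map _
  have hT1 := ev_ker T m
  suffices Module.finrank (ZMod 3) (LinearMap.ker (ev T m)) ≤ (low ι m).card by omega
  -- weights on T
  let w : T → ZMod 3 := fun t => h ⟨t.1, (hTA t.1 t.2).1⟩
  have hw : ∀ t, w t ≠ 0 := fun t => (hTA t.1 t.2).2
  let W : Submodule (ZMod 3) (T → ZMod 3) :=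
    Submodule.span (ZMod 3) (Set.range (fun γ : low ι m => fun y : T => mon γ.1 y.1))
  have hW : Module.finrank (ZMod 3) W ≤ (low ι m).card := by
    have := finrank_range_le_card (R := ZMod 3) (fun γ : low ι m => fun y : T => mon γ.1 y.1)
    rwa [Fintype.card_coe] at this
  refine le_trans ?_ hW
  have hmem : ∀ g ∈ LinearMap.ker (ev T m), (fun y => w y * g y) ∈ W := by
    intro g hg
    have e1 : (fun y : T => w y * g y) = fun y : T => ∑ x : A, ∑ z : T, h x * g z *
        (if x.1 + y.1 + z.1 = 0 then (1 : ZMod 3) else 0) := by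
      ext y
      have hyA := (hTA y.1 y.2).1
      rw [Finset.sum_eq_single ⟨y.1, hyA⟩, Finset.sum_eq_single y]
      · have : y.1 + y.1 + y.1 = 0 := by
          ext i; simp only [Pi.add_apply, Pi.zero_apply]
          generalize y.1 i = u; revert u; decide
        simp [this, w]
      · intro z _ hz
        rw [if_neg, mul_zero]
        intro h0
        exact hz (Subtype.ext (hA _ hyA _ hyA _ (hTA z.1 z.2).1 h0).2.symm)
      · simp
      · intro x _ hx
        apply Finset.sum_eq_zero
        intro z _
        rw [if_neg, mul_zero]
        intro h0
        exact hx (Subtype.ext (hA _ x.2 _ hyA _ (hTA z.1 z.2).1 h0).1)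
      · simp
    have e2 : (fun y : T => w y * g y) = ∑ f : ι → Fin 3 × Fin 3 × Fin 3,
        ((∏ i, cf (f i)) * (∑ x : A, h x * mon (fun i => (f i).1) x.1) *
          (∑ z : T, g z * mon (fun i => (f i).2.2) z.1)) •
          (fun y : T => mon (fun i => (f i).2.1) y.1) := by
      rw [e1]
      ext y
      simp_rw [tensor_expand, Finset.mul_sum]
      rw [Finset.sum_apply]
      simp_rw [Pi.smul_apply, smul_eq_mul, Finset.sum_mul]
      simp_rw [Finset.sum_comm (s := (Finset.univ : Finset T)) (t := (Finset.univ : Finset (ι → Fin 3 × Fin 3 × Fin 3)))]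
      rw [Finset.sum_comm]
      refine Finset.sum_congr rfl fun f _ => ?_
      rw [Finset.sum_comm]
      refine Finset.sum_congr rfl fun z _ => ?_
      refine Finset.sum_congr rfl fun x _ => ?_
      ring
    rw [e2]
    apply Submodule.sum_mem
    intro f _
    by_cases hf : ∏ i, cf (f i) = 0
    · simp [hf]
    rcases key e hι f hf with h1 | h1 | h1
    · have := congrFun (LinearMap.mem_ker.mp hK) ⟨_, h1⟩
      simp only [ev, LinearMap.coe_mk, AddHom.coe_mk, Pi.zero_apply] at this
      rw [this]; simp
    · exact Submodule.smul_mem _ _ (Submodule.subset_span ⟨⟨_, h1⟩, rfl⟩)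
    · have := congrFun (LinearMap.mem_ker.mp hg) ⟨_, h1⟩
      simp only [ev, LinearMap.coe_mk, AddHom.coe_mk, Pi.zero_apply] at this
      rw [this]; simp
  let ψ : LinearMap.ker (ev T m) →ₗ[ZMod 3] W :=
    { toFun := fun g => ⟨fun y => w y * g.1 y, hmem g.1 g.2⟩
      map_add' := by intro g g'; ext y; simp [mul_add]
      map_smul' := by intro c g; ext y; simp; ring }
  apply LinearMap.finrank_le_finrank_of_injective (f := ψ)
  intro g g' hgg
  ext y
  have := congrFun (congrArg Subtype.val hgg) y
  exact mul_left_cancel₀ (hw y) this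

theorem low_bound (e : ℕ) (hι : Fintype.card ι = 3 * e) (t : ℝ) (h0 : 0 < t) (h1 : t ≤ 1) :
    ((low ι (2 * e)).card : ℝ) * t ^ (2 * e) ≤ (1 + t + t ^ 2) ^ (3 * e) := by
  have : (1 + t + t ^ 2) ^ (3 * e) = ∑ α : ι → Fin 3, t ^ (∑ i, (α i : ℕ)) := by
    have h2 : (1 + t + t ^ 2) = ∑ a : Fin 3, t ^ (a : ℕ) := by
      simp [Fin.sum_univ_three]
    rw [h2, ← hι, ← Finset.card_univ, ← Finset.prod_const, Finset.prod_univ_sum,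
      Fintype.piFinset_univ]
    refine Finset.sum_congr rfl fun α _ => ?_
    rw [Finset.prod_pow_eq_pow_sum]
  rw [this, ← nsmul_eq_mul, ← Finset.sum_const]
  refine le_trans (Finset.sum_le_sum (g := fun α => t ^ (∑ i, (α i : ℕ))) ?_)
    (Finset.sum_le_sum_of_subset_of_nonneg (Finset.subset_univ _) ?_)
  · intro α hα
    simp only [low, Finset.mem_filter] at hα
    exact pow_le_pow_of_le_one h0.le h1 hα.2
  · intros; positivity

theorem fiber_bound (e : ℕ) (hι : Fintype.card ι = 3 * e) (A : Finset (ι → ZMod 3)) :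
    A.card ≤ 3 * (low ι (2 * e)).card + (Finset.univ.filter
      (fun p : (ι → ZMod 3) × (ι → ZMod 3) => p.2 ≠ 0 ∧ p.1 ∈ A ∧ p.1 + p.2 ∈ A ∧
        p.1 + 2 • p.2 ∈ A)).card := by
  set L := Finset.univ.filter
      (fun p : (ι → ZMod 3) × (ι → ZMod 3) => p.2 ≠ 0 ∧ p.1 ∈ A ∧ p.1 + p.2 ∈ A ∧
        p.1 + 2 • p.2 ∈ A) with hL
  have h1 := cap_bound e hι (A \ L.image Prod.fst) (by
    intro x hx y hy z hz h
    have hz' : z = x + 2 • (y - x) := by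
      ext i
      have := congrFun h i
      simp only [Pi.add_apply, Pi.smul_apply, Pi.sub_apply, Pi.zero_apply] at this ⊢
      generalize x i = a at *
      generalize y i = b at *
      generalize z i = c at *
      revert a b c; decide
    by_cases hxy : x = y
    · subst hxy; simp at hz'; exact ⟨rfl, hz'.symm⟩
    · exfalso
      rw [Finset.mem_sdiff] at hx hy hz
      apply hx.2
      refine Finset.mem_image.mpr ⟨(x, y - x), ?_, rfl⟩
      simp only [hL, Finset.mem_filter, Finset.mem_univ, true_and]
      refine ⟨sub_ne_zero.mpr (Ne.symm hxy), hx.1, ?_, hz' ▸ hz.1⟩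
      simpa using hy.1)
  have h2 : A.card ≤ (A \ L.image Prod.fst).card + (L.image Prod.fst).card := by
    have := Finset.le_card_sdiff (L.image Prod.fst) A
    omega
  have h3 : (L.image Prod.fst).card ≤ L.card := Finset.card_image_le
  omega

theorem main_bound {X Y : Type} [Fintype X] [Fintype Y] [DecidableEq X] [DecidableEq Y]
    (e : ℕ) (hι : Fintype.card ι = 3 * e) (S : X → Y → Finset (ι → ZMod 3))
    (hS : ∀ x x' y z d, x ≠ x' → d ≠ 0 → z ∈ S x y → z + d ∈ S x y → z + 2 • d ∈ S x y →
      z ∈ S x' y → z + d ∈ S x' y → z + 2 • d ∈ S x' y → False) :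
    ∑ y, ∑ x, (S x y).card ≤
      Fintype.card Y * (Fintype.card X * (3 * (low ι (2 * e)).card) + 9 ^ (3 * e)) := by
  have : ∀ y ∈ Finset.univ, ∑ x, (S x y).card ≤
      Fintype.card X * (3 * (low ι (2 * e)).card) + 9 ^ (3 * e) := by
    intro y _
    refine le_trans (Finset.sum_le_sum fun x _ => fiber_bound e hι (S x y)) ?_
    rw [Finset.sum_add_distrib, Finset.sum_const, Finset.card_univ, smul_eq_mul]
    gcongr
    rw [← Finset.card_biUnion]
    · refine le_trans (Finset.card_le_univ _) ?_
      rw [Fintype.card_prod, Fintype.card_fun, hι, ZMod.card, ← mul_pow]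
      norm_num
    · intro x _ x' _ hx
      change Disjoint _ _
      rw [Finset.disjoint_left]
      intro p hp hp'
      simp only [Finset.mem_filter, Finset.mem_univ, true_and] at hp hp'
      exact hS x x' y p.1 p.2 hx hp.1 hp.2.1 hp.2.2.1 hp.2.2.2 hp'.2.1 hp'.2.2.1 hp'.2.2.2
  refine le_trans (Finset.sum_le_sum this) ?_
  rw [Finset.sum_const, Finset.card_univ, smul_eq_mul]

def cc (a : ZMod 2) (b : ZMod 3) : ZMod 6 := ((3 * a.val + 4 * b.val : ℕ) : ZMod 6)

theorem cc_surj : ∀ u : ZMod 6, ∃ a b, cc a b = u := by decide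

theorem cc_two : ∀ (a : ZMod 2) (b : ZMod 3), a ≠ 0 → 3 * cc a b ≠ 0 := by decide

theorem cc_three : ∀ (a : ZMod 2) (b : ZMod 3), b ≠ 0 → 2 * cc a b ≠ 0 := by decide

theorem inj6 : ∀ u v : ZMod 6, 3 * u ≠ 0 → 2 * v ≠ 0 → ∀ i < 6, ∀ j < 6,
    i • u = j • u → i • v = j • v → i = j := by decide

theorem cc_step : ∀ (a a' : ZMod 2) (b d : ZMod 3),
    cc a b + 0 • cc (a' - a) d = cc a b ∧
    cc a b + 1 • cc (a' - a) d = cc a' (b + d) ∧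
    cc a b + 2 • cc (a' - a) d = cc a (b + 2 • d) ∧
    cc a b + 3 • cc (a' - a) d = cc a' b ∧
    cc a b + 4 • cc (a' - a) d = cc a (b + d) ∧
    cc a b + 5 • cc (a' - a) d = cc a' (b + 2 • d) := by decide

def psi {m l : ℕ} (x : Fin (m + l) → ZMod 2) (y : Fin l → ZMod 3) (z : Fin m → ZMod 3) :
    Fin (m + l) → ZMod 6 := fun i => cc (x i) (Fin.append z y i)

theorem psi_step {m l : ℕ} (x x' : Fin (m + l) → ZMod 2) (y : Fin l → ZMod 3)
    (z d : Fin m → ZMod 3) :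
    psi x y z + 0 • psi (x' - x) 0 d = psi x y z ∧
    psi x y z + 1 • psi (x' - x) 0 d = psi x' y (z + d) ∧
    psi x y z + 2 • psi (x' - x) 0 d = psi x y (z + 2 • d) ∧
    psi x y z + 3 • psi (x' - x) 0 d = psi x' y z ∧
    psi x y z + 4 • psi (x' - x) 0 d = psi x y (z + d) ∧
    psi x y z + 5 • psi (x' - x) 0 d = psi x' y (z + 2 • d) := by
  have hp : ∀ i, Fin.append (z + d) y i = Fin.append z y i + Fin.append d 0 i ∧
      Fin.append (z + 2 • d) y i = Fin.append z y i + 2 • Fin.append d (0 : Fin l → ZMod 3) i := by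
    intro i
    induction i using Fin.addCases with
    | left i => simp
    | right i => simp
  have h := fun i => cc_step (x i) (x' i) (Fin.append z y i) (Fin.append d 0 i)
  refine ⟨?_, ?_, ?_, ?_, ?_, ?_⟩ <;> funext i <;>
    simp only [psi, Pi.add_apply, Pi.smul_apply, Pi.sub_apply, (hp i).1, (hp i).2]
  · exact (h i).1
  · exact (h i).2.1
  · exact (h i).2.2.1
  · exact (h i).2.2.2.1
  · exact (h i).2.2.2.2.1
  · exact (h i).2.2.2.2.2

theorem nat_bound (e l : ℕ) (S : Finset (Fin (3 * e + l) → ZMod 6))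
    (hS : ∀ E, APEdge 6 (3 * e + l) E → ¬ E ⊆ S) :
    S.card ≤ 3 ^ l * (2 ^ (3 * e + l) * (3 * (low (Fin (3 * e)) (2 * e)).card) + 9 ^ (3 * e)) := by
  classical
  let S' : (Fin (3 * e + l) → ZMod 2) → (Fin l → ZMod 3) → Finset (Fin (3 * e) → ZMod 3) :=
    fun x y => Finset.univ.filter (fun z => psi x y z ∈ S)
  have hm := main_bound e (Fintype.card_fin _) S' (by
    intro x x' y z d hx hd h1 h2 h3 h4 h5 h6
    simp only [S', Finset.mem_filter, Finset.mem_univ, true_and] at h1 h2 h3 h4 h5 h6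
    refine hS ((Finset.range 6).image (fun i => psi x y z + i • psi (x' - x) 0 d)) ⟨?_, _, _, rfl⟩ ?_
    · rw [Finset.card_image_of_injOn, Finset.card_range]
      intro i hi j hj hij
      simp only [Finset.coe_range, Set.mem_Iio] at hi hj
      have hij' : i • psi (x' - x) 0 d = j • psi (x' - x) 0 d := add_left_cancel hij
      obtain ⟨p, hp⟩ := Function.ne_iff.mp (sub_ne_zero.mpr (Ne.symm hx))
      obtain ⟨q, hq⟩ := Function.ne_iff.mp hd
      refine inj6 (psi (x' - x) 0 d p) (psi (x' - x) 0 d (Fin.castAdd l q)) ?_ ?_ i hi j hj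
        (congrFun hij' p) (congrFun hij' _)
      · exact cc_two _ _ hp
      · apply cc_three
        rw [Fin.append_left]; exact hq
    · intro v hv
      obtain ⟨i, hi, rfl⟩ := Finset.mem_image.mp hv
      rw [Finset.mem_range] at hi
      obtain ⟨s0, s1, s2, s3, s4, s5⟩ := psi_step x x' y z d
      interval_cases i
      · rw [s0]; exact h1
      · rw [s1]; exact h5
      · rw [s2]; exact h3
      · rw [s3]; exact h4
      · rw [s4]; exact h2
      · rw [s5]; exact h6)
  simp only [Fintype.card_fun, ZMod.card, Fintype.card_fin] at hm
  refine le_trans ?_ hm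
  have hsub : S ⊆ Finset.univ.biUnion (fun y => Finset.univ.biUnion
      (fun x => (S' x y).image (psi x y))) := by
    intro v hv
    choose a b hab using fun i => cc_surj (v i)
    simp only [Finset.mem_biUnion, Finset.mem_univ, true_and, Finset.mem_image]
    have hpsi : psi a (fun i => b (Fin.natAdd (3 * e) i)) (fun i => b (Fin.castAdd l i)) = v := by
      funext i
      rw [← hab i]
      simp only [psi]
      congr 1
      induction i using Fin.addCases with
      | left i => simp
      | right i => simp
    refine ⟨_, _, _, ?_, hpsi⟩
    simp only [S', Finset.mem_filter, Finset.mem_univ, true_and]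
    rw [hpsi]; exact hv
  refine le_trans (Finset.card_le_card hsub) ?_
  refine le_trans Finset.card_biUnion_le (Finset.sum_le_sum fun y _ => ?_)
  refine le_trans Finset.card_biUnion_le (Finset.sum_le_sum fun x _ => ?_)
  exact Finset.card_image_le

noncomputable def G : ℝ := (1 + 0.593 + 0.593 ^ 2) ^ 3 / 0.593 ^ 2

theorem G_pos : 0 < G := by unfold G; positivity

theorem low_G (e : ℕ) : ((low (Fin (3 * e)) (2 * e)).card : ℝ) ≤ G ^ e := by
  have := low_bound (ι := Fin (3 * e)) e (Fintype.card_fin _) 0.593 (by norm_num) (by norm_num)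
  rw [G, div_pow, ← pow_mul, ← pow_mul, le_div_iff₀ (by positivity)]
  exact this

noncomputable def aa : ℝ := 6 ^ 41 * (G / 27) ^ 8
noncomputable def bb : ℝ := 3 ^ 41 * 27 ^ 8

theorem aa_lt : aa < 5.709 ^ 41 := by unfold aa G; norm_num
theorem bb_lt : bb < 5.709 ^ 41 := by unfold bb; norm_num

theorem real_bound (m r : ℕ) (hr : r < 41) (S : Finset (Fin (41 * m + r) → ZMod 6))
    (hS : ∀ E, APEdge 6 (41 * m + r) E → ¬ E ⊆ S) :
    (S.card : ℝ) ≤ 6 ^ 41 * (3 * aa ^ m + bb ^ m) := by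
  obtain ⟨e, he⟩ : ∃ e, e = 8 * m := ⟨_, rfl⟩
  obtain ⟨l, hl⟩ : ∃ l, 41 * m + r = 3 * e + l := ⟨17 * m + r, by omega⟩
  have hl' : l = 17 * m + r := by omega
  have key : (S.card : ℝ) ≤ 3 ^ l * (2 ^ (3 * e + l) * (3 * G ^ e) + 9 ^ (3 * e)) := by
    have h1 : S.card ≤ 3 ^ l * (2 ^ (3 * e + l) * (3 * (low (Fin (3 * e)) (2 * e)).card) + 9 ^ (3 * e)) := by
      clear hl'
      revert S
      rw [hl]
      exact fun S hS => nat_bound e l S hS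
    have h2 : (S.card : ℝ) ≤ 3 ^ l * (2 ^ (3 * e + l) * (3 * ((low (Fin (3 * e)) (2 * e)).card : ℝ)) + 9 ^ (3 * e)) := by
      exact_mod_cast h1
    refine h2.trans ?_
    gcongr
    exact low_G e
  refine key.trans ?_
  have hA : (0 : ℝ) ≤ aa ^ m := by have := G_pos; unfold aa; positivity
  have hB : (0 : ℝ) ≤ bb ^ m := by unfold bb; positivity
  have e1 : (3 : ℝ) ^ l * (2 ^ (3 * e + l) * (3 * G ^ e) + 9 ^ (3 * e)) =
      6 ^ r * (3 * aa ^ m) + 3 ^ r * bb ^ m := by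
    have a1 : aa = 3 ^ 17 * 2 ^ 41 * G ^ 8 := by unfold aa; ring
    have b1 : bb = 3 ^ 17 * 9 ^ 24 := by unfold bb; norm_num
    have c1 : 3 * e + l = 41 * m + r := hl.symm
    have c2 : 3 * e = 24 * m := by omega
    rw [c1, c2, hl', he, a1, b1, show (6 : ℝ) = 3 * 2 by norm_num]
    simp only [mul_pow, pow_add, pow_mul]
    ring
  rw [e1]
  have h6 : (6 : ℝ) ^ r ≤ 6 ^ 41 := pow_le_pow_right₀ (by norm_num) hr.le
  have h3 : (3 : ℝ) ^ r ≤ 6 ^ 41 :=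
    (pow_le_pow_left₀ (by norm_num) (by norm_num) r).trans h6
  rw [mul_add]
  gcongr

theorem eventually_bound : ∃ M : ℕ, ∀ m ≥ M,
    6 ^ 41 * (3 * aa ^ m + bb ^ m) ≤ ((5.709 : ℝ) ^ 41) ^ m := by
  have ha0 : 0 ≤ aa := by have := G_pos; unfold aa; positivity
  have hb0 : 0 ≤ bb := by unfold bb; positivity
  have hc : (0 : ℝ) < 5.709 ^ 41 := by positivity
  have ta := tendsto_pow_atTop_nhds_zero_of_lt_one (div_nonneg ha0 hc.le) ((div_lt_one hc).mpr aa_lt)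
  have tb := tendsto_pow_atTop_nhds_zero_of_lt_one (div_nonneg hb0 hc.le) ((div_lt_one hc).mpr bb_lt)
  have t := ((ta.const_mul 3).add tb).const_mul ((6 : ℝ) ^ 41)
  rw [mul_zero, add_zero, mul_zero] at t
  have ev := t.eventually (gt_mem_nhds (zero_lt_one (α := ℝ)))
  obtain ⟨M, hM⟩ := Filter.eventually_atTop.mp ev
  refine ⟨M, fun m hm => ?_⟩
  have h := hM m hm
  rw [div_pow, div_pow] at h
  have hcm : (0 : ℝ) < (5.709 ^ 41) ^ m := by positivity
  generalize ((5.709 : ℝ) ^ 41) ^ m = C at h hcm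
  generalize (6 : ℝ) ^ 41 = D at h ⊢
  have : D * (3 * (aa ^ m / C) + bb ^ m / C) = (D * (3 * aa ^ m + bb ^ m)) / C := by ring
  rw [this, div_lt_one hcm] at h
  exact h.le

theorem num_bound : (5.709 : ℝ) ≤ (6 : ℝ) ^ (0.973 : ℝ) := by
  have h : (5.709 : ℝ) ^ 37 ≤ 6 ^ 36 := by norm_num
  have h2 : ((6 : ℝ) ^ (36 / 37 : ℝ)) ^ 37 = 6 ^ 36 := by
    rw [← Real.rpow_natCast, ← Real.rpow_mul (by norm_num), ← Real.rpow_natCast]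
    norm_num
  rw [← h2] at h
  refine (le_of_pow_le_pow_left₀ (by norm_num) (by positivity) h).trans ?_
  exact Real.rpow_le_rpow_of_exponent_le (by norm_num) (by norm_num)

end Cap6

theorem stmt8 :
    ∃ K : ℕ, ∀ k : ℕ, K ≤ k →
      (∀ S : Finset (Fin k → ZMod 6), (∀ E, APEdge 6 k E → ¬ E ⊆ S) →
        (S.card : ℝ) ≤ (5.709 : ℝ) ^ k) ∧
      (∀ S : Finset (Fin k → ZMod 6), (∀ E, APEdge 6 k E → ¬ E ⊆ S) →
        (S.card : ℝ) ≤ (((6 : ℝ) ^ k) ^ (0.973 : ℝ))) := by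
  obtain ⟨M, hM⟩ := Cap6.eventually_bound
  have main : ∀ k : ℕ, 41 * M ≤ k → ∀ S : Finset (Fin k → ZMod 6),
      (∀ E, APEdge 6 k E → ¬ E ⊆ S) → (S.card : ℝ) ≤ (5.709 : ℝ) ^ k := by
    intro k hk
    obtain ⟨m, r, hr, rfl⟩ : ∃ m r, r < 41 ∧ k = 41 * m + r :=
      ⟨k / 41, k % 41, Nat.mod_lt _ (by norm_num), (Nat.div_add_mod k 41).symm⟩
    intro S hS
    refine (Cap6.real_bound m r hr S hS).trans ((hM m (by omega)).trans ?_)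
    rw [← pow_mul]
    exact pow_le_pow_right₀ (by norm_num) (by omega)
  refine ⟨41 * M, fun k hk => ⟨main k hk, fun S hS => (main k hk S hS).trans ?_⟩⟩
  rw [← Real.rpow_natCast 6 k, ← Real.rpow_mul (by norm_num), mul_comm, Real.rpow_mul (by norm_num),
    Real.rpow_natCast]
  exact pow_le_pow_left₀ (by norm_num) Cap6.num_bound k
end

section
/- For every integer k ≥ 1 there exists a (3^k, 5, 4)-system with independence number at most 7·2^k − (√2/(2−√3))·3^{k/2}. -/
lemma design_transfer {V W : Type*} [DecidableEq V] [DecidableEq W] (g : V ≃ W)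
    (H : Finset (Finset V)) (A : ℝ) (h1 : IsDesign 5 4 H) (h2 : IndepAtMost H A) :
    ∃ H' : Finset (Finset W), IsDesign 5 4 H' ∧ IndepAtMost H' A := by
  refine ⟨H.image (fun e => e.map g.toEmbedding), ⟨?_, ?_⟩, ?_⟩
  · intro e he
    obtain ⟨a, ha, rfl⟩ := Finset.mem_image.1 he
    simpa using h1.1 a ha
  · intro e he f hf hne
    obtain ⟨a, ha, rfl⟩ := Finset.mem_image.1 he
    obtain ⟨b, hb, rfl⟩ := Finset.mem_image.1 hf
    rw [← Finset.map_inter, Finset.card_map]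
    exact h1.2 a ha b hb (fun h => hne (by rw [h]))
  · intro S hS
    have := h2 (S.map g.symm.toEmbedding) (by
      intro e he hsub
      apply hS _ (Finset.mem_image_of_mem _ he)
      intro y hy
      obtain ⟨x, hx, rfl⟩ := Finset.mem_map.1 hy
      obtain ⟨w, hw, hwx⟩ := Finset.mem_map.1 (hsub hx)
      have : g x = w := by rw [← hwx]; simp
      simpa [this] using hw)
    simpa using this

/-- A cross edge. -/
def crossEdge {V : Type*} [DecidableEq V] (x x' z z' u : V) : Finset (Fin 3 × V) :=
  {(0, x), (0, x'), (1, z), (1, z'), (2, u)}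

lemma mem_cross {V : Type*} [DecidableEq V] (x x' z z' u : V) (p : Fin 3 × V) :
    p ∈ crossEdge x x' z z' u ↔
      p = (0, x) ∨ p = (0, x') ∨ p = (1, z) ∨ p = (1, z') ∨ p = (2, u) := by
  simp [crossEdge]

lemma cross_card {V : Type*} [DecidableEq V] (x x' z z' u : V) (hx : x ≠ x') (hz : z ≠ z') :
    (crossEdge x x' z z' u).card = 5 := by
  unfold crossEdge
  rw [Finset.card_insert_of_notMem, Finset.card_insert_of_notMem, Finset.card_insert_of_notMem,
    Finset.card_insert_of_notMem, Finset.card_singleton] <;> simp [hx, hz]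

lemma pair_sum {V F : Type*} [Field F] (φ : V → F)
    (x x' y y' : V) (hx : x ≠ x')
    (h1 : x = y ∨ x = y') (h2 : x' = y ∨ x' = y') :
    φ x + φ x' = φ y + φ y' ∧ ((x = y ∧ x' = y') ∨ (x = y' ∧ x' = y)) := by
  rcases h1 with rfl | rfl <;> rcases h2 with rfl | rfl <;> simp_all [add_comm]

lemma pair_rest {V F : Type*} [Field F] (φ : V → F) (hφ : Function.Injective φ)
    (x x' y y' : V)
    (h1 : (x = y ∨ x = y') ∨ (x' = y ∨ x' = y')) (h2 : φ x + φ x' = φ y + φ y') :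
    ((x = y ∧ x' = y') ∨ (x = y' ∧ x' = y)) := by
  rcases h1 with (rfl | rfl) | (rfl | rfl)
  · left; exact ⟨rfl, hφ (by linear_combination h2)⟩
  · right; exact ⟨rfl, hφ (by linear_combination h2)⟩
  · right; exact ⟨hφ (by linear_combination h2), rfl⟩
  · left; exact ⟨hφ (by linear_combination h2), rfl⟩

lemma cross_inter {V F : Type*} [DecidableEq V] [Field F] [CharP F 2] (φ ψ : V → F)
    (hφ : Function.Injective φ) (hψ : Function.Injective ψ) (hψ0 : ∀ u, ψ u ≠ 0)
    (x x' z z' u y y' w w' v : V) (hx : x ≠ x') (hz : z ≠ z')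
    (hE : φ z + φ z' = ψ u * (φ x + φ x')) (hE' : φ w + φ w' = ψ v * (φ y + φ y'))
    (hne : crossEdge x x' z z' u ≠ crossEdge y y' w w' v) :
    (crossEdge x x' z z' u ∩ crossEdge y y' w w' v).card < 4 := by
  by_contra hcon
  push Not at hcon
  apply hne
  have hc := cross_card x x' z z' u hx hz
  have hd : (crossEdge x x' z z' u \ crossEdge y y' w w' v).card ≤ 1 := by
    have := Finset.card_sdiff_add_card_inter (crossEdge x x' z z' u) (crossEdge y y' w w' v)
    omega
  rw [Finset.card_le_one] at hd
  have key : ∀ a ∈ crossEdge x x' z z' u, ∀ b ∈ crossEdge x x' z z' u, a ≠ b →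
      a ∈ crossEdge y y' w w' v ∨ b ∈ crossEdge y y' w w' v := by
    intro a ha b hb hab
    by_contra hh
    push Not at hh
    exact hab (hd a (by simp [ha, hh.1]) b (by simp [hb, hh.2]))
  have m0 : ∀ t, ((0 : Fin 3), t) ∈ crossEdge y y' w w' v ↔ (t = y ∨ t = y') := by
    intro t; simp [mem_cross]
  have m1 : ∀ t, ((1 : Fin 3), t) ∈ crossEdge y y' w w' v ↔ (t = w ∨ t = w') := by
    intro t; simp [mem_cross]
  have m2 : ∀ t, ((2 : Fin 3), t) ∈ crossEdge y y' w w' v ↔ t = v := by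
    intro t; simp [mem_cross]
  have k00 := key (0, x) (by simp [mem_cross]) (0, x') (by simp [mem_cross]) (by simp [hx])
  have k11 := key (1, z) (by simp [mem_cross]) (1, z') (by simp [mem_cross]) (by simp [hz])
  have k1 := key (0, x) (by simp [mem_cross]) (1, z) (by simp [mem_cross]) (by simp)
  have k2 := key (0, x) (by simp [mem_cross]) (1, z') (by simp [mem_cross]) (by simp)
  have k3 := key (0, x') (by simp [mem_cross]) (1, z) (by simp [mem_cross]) (by simp)
  have k4 := key (0, x') (by simp [mem_cross]) (1, z') (by simp [mem_cross]) (by simp)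
  have k5 := key (0, x) (by simp [mem_cross]) (2, u) (by simp [mem_cross]) (by simp)
  have k6 := key (0, x') (by simp [mem_cross]) (2, u) (by simp [mem_cross]) (by simp)
  have k7 := key (1, z) (by simp [mem_cross]) (2, u) (by simp [mem_cross]) (by simp)
  have k8 := key (1, z') (by simp [mem_cross]) (2, u) (by simp [mem_cross]) (by simp)
  rw [m0, m0] at k00
  rw [m1, m1] at k11
  rw [m0, m1] at k1 k2 k3 k4
  rw [m0, m2] at k5 k6
  rw [m1, m2] at k7 k8
  have hxx : φ x + φ x' ≠ 0 := fun h => hx (hφ (CharTwo.add_eq_zero.1 h))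
  have hfin : ((x = y ∧ x' = y') ∨ (x = y' ∧ x' = y)) ∧
      ((z = w ∧ z' = w') ∨ (z = w' ∧ z' = w)) ∧ u = v := by
    by_cases hu : u = v
    · subst hu
      by_cases h0 : (x = y ∨ x = y') ∧ (x' = y ∨ x' = y')
      · obtain ⟨hs, hp⟩ := pair_sum φ x x' y y' hx h0.1 h0.2
        refine ⟨hp, pair_rest φ hφ z z' w w' k11 ?_, rfl⟩
        rw [hE, hE', hs]
      · have h1 : (z = w ∨ z = w') ∧ (z' = w ∨ z' = w') := by
          by_cases hP : x = y ∨ x = y'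
          · have hQ : ¬ (x' = y ∨ x' = y') := fun hQ => h0 ⟨hP, hQ⟩
            exact ⟨k3.resolve_left hQ, k4.resolve_left hQ⟩
          · exact ⟨k1.resolve_left hP, k2.resolve_left hP⟩
        obtain ⟨hs, hp⟩ := pair_sum φ z z' w w' hz h1.1 h1.2
        refine ⟨pair_rest φ hφ x x' y y' k00 ?_, hp, rfl⟩
        rw [hE, hE'] at hs
        exact mul_left_cancel₀ (hψ0 u) hs
    · obtain ⟨hs, hp⟩ := pair_sum φ x x' y y' hx (k5.resolve_right hu) (k6.resolve_right hu)
      obtain ⟨hs', hp'⟩ := pair_sum φ z z' w w' hz (k7.resolve_right hu) (k8.resolve_right hu)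
      refine ⟨hp, hp', hψ ?_⟩
      rw [hE, hE', ← hs] at hs'
      exact mul_right_cancel₀ hxx hs'
  obtain ⟨h0, h1, rfl⟩ := hfin
  ext p
  rw [mem_cross, mem_cross]
  rcases h0 with ⟨rfl, rfl⟩ | ⟨rfl, rfl⟩ <;> rcases h1 with ⟨rfl, rfl⟩ | ⟨rfl, rfl⟩ <;> clear * - <;> grind

lemma cross_copy {V : Type*} [DecidableEq V] (x x' z z' u : V) (i : Fin 3)
    (e : Finset V) :
    (crossEdge x x' z z' u ∩ e.image (fun t => (i, t))).card < 4 := by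
  have hsub : crossEdge x x' z z' u ∩ e.image (fun t => (i, t)) ⊆
      {(i, x), (i, x')} ∨ crossEdge x x' z z' u ∩ e.image (fun t => (i, t)) ⊆
      {(i, z), (i, z')} ∨ crossEdge x x' z z' u ∩ e.image (fun t => (i, t)) ⊆
      {(i, u), (i, u)} := by
    fin_cases i
    · left; intro p; simp [mem_cross]; grind
    · right; left; intro p; simp [mem_cross]; grind
    · right; right; intro p; simp [mem_cross]; grind
  rcases hsub with h | h | h <;>
    exact lt_of_le_of_lt ((Finset.card_le_card h).trans Finset.card_le_two) (by norm_num)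

lemma inj_pair {V : Type*} (i : Fin 3) : Function.Injective (fun t : V => (i, t)) := by
  intro a b h
  simpa using h

lemma design_step (n : ℕ) (F : Type) [Field F] [Fintype F] [CharP F 2]
    (φ ψ : Fin n → F)
    (hφ : Function.Injective φ) (hψ : Function.Injective ψ) (hψ0 : ∀ u, ψ u ≠ 0)
    (hcard : Fintype.card F ≤ 2 * n)
    (H : Finset (Finset (Fin n))) (A : ℝ) (h1 : IsDesign 5 4 H) (h2 : IndepAtMost H A) :
    ∃ H' : Finset (Finset (Fin 3 × Fin n)), IsDesign 5 4 H' ∧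
      IndepAtMost H' (2 * A + Real.sqrt (2 * n)) := by
  classical
  let H' : Finset (Finset (Fin 3 × Fin n)) := Finset.univ.filter (fun E =>
    (∃ i : Fin 3, ∃ e ∈ H, E = e.image (fun t => (i, t))) ∨
    ∃ x x' z z' u, x ≠ x' ∧ z ≠ z' ∧ φ z + φ z' = ψ u * (φ x + φ x') ∧
      E = crossEdge x x' z z' u)
  have hmem : ∀ E, E ∈ H' ↔ ((∃ i : Fin 3, ∃ e ∈ H, E = e.image (fun t => (i, t))) ∨
    ∃ x x' z z' u, x ≠ x' ∧ z ≠ z' ∧ φ z + φ z' = ψ u * (φ x + φ x') ∧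
      E = crossEdge x x' z z' u) := by intro E; simp [H']
  refine ⟨H', ⟨?_, ?_⟩, ?_⟩
  · intro E hE
    rcases (hmem E).1 hE with ⟨i, e, he, rfl⟩ | ⟨x, x', z, z', u, hx, hz, -, rfl⟩
    · rw [Finset.card_image_of_injective _ (inj_pair i)]
      exact h1.1 e he
    · exact cross_card _ _ _ _ _ hx hz
  · intro E hE E' hE' hne
    rcases (hmem E).1 hE with ⟨i, e, he, rfl⟩ | ⟨x, x', z, z', u, hx, hz, hr, rfl⟩ <;>
    rcases (hmem E').1 hE' with ⟨j, f, hf, rfl⟩ | ⟨y, y', w, w', v, hy, hw, hr', rfl⟩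
    · by_cases hij : i = j
      · subst hij
        rw [← Finset.image_inter _ _ (inj_pair i), Finset.card_image_of_injective _ (inj_pair i)]
        exact h1.2 e he f hf (fun h => hne (by rw [h]))
      · have : e.image (fun t => (i, t)) ∩ f.image (fun t => (j, t)) = ∅ := by
          ext p
          simp only [Finset.mem_inter, Finset.mem_image, Finset.notMem_empty, iff_false]
          rintro ⟨⟨a, -, rfl⟩, ⟨b, -, hb⟩⟩
          exact hij (Prod.mk.inj hb).1.symm
        rw [this]; simp
    · rw [Finset.inter_comm]; exact cross_copy _ _ _ _ _ _ _
    · exact cross_copy _ _ _ _ _ _ _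
    · exact cross_inter φ ψ hφ hψ hψ0 _ _ _ _ _ _ _ _ _ _ hx hz hr hr' hne
  · intro S hS
    let T : Fin 3 → Finset (Fin n) := fun i => Finset.univ.filter (fun t => (i, t) ∈ S)
    have hT : ∀ i t, t ∈ T i ↔ (i, t) ∈ S := by intro i t; simp [T]
    have hTA : ∀ i, ((T i).card : ℝ) ≤ A := by
      intro i
      apply h2
      intro e he hsub
      apply hS (e.image (fun t => (i, t))) ((hmem _).2 (Or.inl ⟨i, e, he, rfl⟩))
      intro p hp
      obtain ⟨t, ht, rfl⟩ := Finset.mem_image.1 hp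
      exact (hT i t).1 (hsub ht)
    have hsum : S.card = (T 0).card + (T 1).card + (T 2).card := by
      have : S.card = ∑ i : Fin 3, (S.filter (fun p => p.1 = i)).card :=
        Finset.card_eq_sum_card_fiberwise (fun _ _ => Finset.mem_coe.2 (Finset.mem_univ _))
      rw [this, Fin.sum_univ_three]
      have hh : ∀ i, (S.filter (fun p => p.1 = i)).card = (T i).card := by
        intro i
        rw [← Finset.card_image_of_injective (T i) (inj_pair i)]
        congr 1
        ext ⟨j, t⟩
        simp [T]
        grind
      rw [hh, hh, hh]
    have hsmall : ((T 0).card : ℝ) ≤ Real.sqrt (2 * n) ∨ ((T 1).card : ℝ) ≤ Real.sqrt (2 * n) ∨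
        ((T 2).card : ℝ) ≤ Real.sqrt (2 * n) := by
      by_contra hcon
      push Not at hcon
      obtain ⟨c0, c1, c2⟩ := hcon
      have s0 := Real.sqrt_nonneg (2 * (n : ℝ))
      have hpos : 0 < (T 2).card := by
        have : (0 : ℝ) < (T 2).card := lt_of_le_of_lt s0 c2
        exact_mod_cast this
      obtain ⟨u, hu⟩ := Finset.card_pos.1 hpos
      have hprod : 2 * n < (T 0).card * (T 1).card := by
        have hs : Real.sqrt (2 * n) * Real.sqrt (2 * n) = 2 * (n : ℝ) :=
          Real.mul_self_sqrt (by positivity)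
        have : (2 * n : ℝ) < (T 0).card * (T 1).card := by
          rw [← hs]; exact mul_lt_mul'' c0 c1 s0 s0
        exact_mod_cast this
      have hlt : (Finset.univ : Finset F).card < (T 0 ×ˢ T 1).card := by
        rw [Finset.card_product, Finset.card_univ]; omega
      obtain ⟨⟨x, z⟩, hp, ⟨x', z'⟩, hp', hne, heq⟩ :=
        Finset.exists_ne_map_eq_of_card_lt_of_maps_to hlt
          (f := fun p => φ p.2 + ψ u * φ p.1) (fun _ _ => Finset.mem_coe.2 (Finset.mem_univ _))
      simp only [Finset.mem_product] at hp hp' heq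
      have hx : x ≠ x' := by
        rintro rfl
        apply hne
        rw [hφ (add_right_cancel heq)]
      have hz : z ≠ z' := by
        rintro rfl
        exact hx (hφ (mul_left_cancel₀ (hψ0 u) (add_left_cancel heq)))
      have hrel : φ z + φ z' = ψ u * (φ x + φ x') := by
        have e1 := CharTwo.add_self_eq_zero (φ z')
        have e2 := CharTwo.add_self_eq_zero (ψ u * φ x)
        linear_combination heq + e1 - e2
      apply hS _ ((hmem _).2 (Or.inr ⟨x, x', z, z', u, hx, hz, hrel, rfl⟩))
      intro p hp''
      rw [hT, hT] at hp hp'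
      rw [hT] at hu
      rcases (mem_cross _ _ _ _ _ _).1 hp'' with rfl | rfl | rfl | rfl | rfl
      · exact hp.1
      · exact hp'.1
      · exact hp.2
      · exact hp'.2
      · exact hu
    rw [hsum]
    push_cast
    have a0 := hTA 0
    have a1 := hTA 1
    have a2 := hTA 2
    rcases hsmall with h | h | h <;> linarith

lemma exists_field (n : ℕ) (hn : 1 ≤ n) : ∃ j : ℕ, j ≠ 0 ∧ n < 2 ^ j ∧ 2 ^ j ≤ 2 * n := by
  refine ⟨Nat.log 2 n + 1, by simp, Nat.lt_pow_succ_log_self (by norm_num) n, ?_⟩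
  have := Nat.pow_log_le_self 2 (show n ≠ 0 by omega)
  rw [pow_succ]; omega

lemma design_step' (n : ℕ) (hn : 1 ≤ n)
    (H : Finset (Finset (Fin n))) (A : ℝ) (h1 : IsDesign 5 4 H) (h2 : IndepAtMost H A) :
    ∃ H' : Finset (Finset (Fin 3 × Fin n)), IsDesign 5 4 H' ∧
      IndepAtMost H' (2 * A + Real.sqrt (2 * n)) := by
  classical
  obtain ⟨j, hj, hlt, hle⟩ := exists_field n hn
  haveI : Fintype (GaloisField 2 j) := Fintype.ofFinite _
  have hc : Fintype.card (GaloisField 2 j) = 2 ^ j := by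
    rw [← Nat.card_eq_fintype_card]; exact GaloisField.card 2 j hj
  have hu : Fintype.card (Fin n) ≤ Fintype.card (GaloisField 2 j)ˣ := by
    rw [Fintype.card_units, hc, Fintype.card_fin]; omega
  obtain ⟨g⟩ := Function.Embedding.nonempty_of_card_le hu
  have hinj : Function.Injective (fun t => ((g t : (GaloisField 2 j)ˣ) : GaloisField 2 j)) :=
    fun a b h => g.injective (Units.ext h)
  exact design_step n (GaloisField 2 j) _ _ hinj hinj (fun u => (g u).ne_zero)
    (by omega) H A h1 h2

lemma stmt_all (k : ℕ) :
    ∃ H : Finset (Finset (Fin (3 ^ k))), IsDesign 5 4 H ∧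
      IndepAtMost H (7 * 2 ^ k - Real.sqrt 2 / (2 - Real.sqrt 3) * (Real.sqrt 3) ^ k) := by
  have s3 : Real.sqrt 3 * Real.sqrt 3 = 3 := Real.mul_self_sqrt (by norm_num)
  have s2 : Real.sqrt 2 * Real.sqrt 2 = 2 := Real.mul_self_sqrt (by norm_num)
  have p3 := Real.sqrt_nonneg 3
  have p2 := Real.sqrt_nonneg 2
  have hd : (0 : ℝ) < 2 - Real.sqrt 3 := by nlinarith
  induction k with
  | zero =>
    refine ⟨∅, ⟨by simp, by simp⟩, ?_⟩
    intro S _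
    have hS : S.card ≤ 1 := by
      have := Finset.card_le_univ S
      simpa using this
    have hS' : (S.card : ℝ) ≤ 1 := by exact_mod_cast hS
    have b3 : Real.sqrt 3 ≤ 1.74 := by nlinarith
    have b2 : Real.sqrt 2 ≤ 1.42 := by nlinarith
    have : Real.sqrt 2 / (2 - Real.sqrt 3) ≤ 6 := by
      rw [div_le_iff₀ hd]; linarith
    simp only [pow_zero, mul_one]
    linarith
  | succ k ih =>
    obtain ⟨H, h1, h2⟩ := ih
    obtain ⟨H', h1', h2'⟩ := design_step' (3 ^ k) (Nat.one_le_pow _ _ (by norm_num)) H _ h1 h2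
    have hval : 2 * (7 * 2 ^ k - Real.sqrt 2 / (2 - Real.sqrt 3) * (Real.sqrt 3) ^ k) +
        Real.sqrt (2 * ((3 ^ k : ℕ) : ℝ)) =
        7 * 2 ^ (k + 1) - Real.sqrt 2 / (2 - Real.sqrt 3) * (Real.sqrt 3) ^ (k + 1) := by
      have : Real.sqrt (2 * ((3 ^ k : ℕ) : ℝ)) = Real.sqrt 2 * Real.sqrt 3 ^ k := by
        rw [Real.sqrt_mul (by norm_num)]
        congr 1
        rw [Real.sqrt_eq_iff_mul_self_eq (by positivity) (by positivity), ← mul_pow, s3]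
        push_cast; rfl
      rw [this, pow_succ, pow_succ]
      field_simp
      ring
    rw [hval] at h2'
    exact design_transfer (finProdFinEquiv.trans (finCongr (by rw [pow_succ]; ring))) H' _ h1' h2'

theorem stmt12 (k : ℕ) (hk : 1 ≤ k) :
    ∃ H : Finset (Finset (Fin (3 ^ k))), IsDesign 5 4 H ∧
      IndepAtMost H (7 * 2 ^ k - Real.sqrt 2 / (2 - Real.sqrt 3) * (3 : ℝ) ^ ((k : ℝ) / 2)) := by
  have h : (3 : ℝ) ^ ((k : ℝ) / 2) = (Real.sqrt 3) ^ k := by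
    rw [Real.sqrt_eq_rpow, ← Real.rpow_natCast, ← Real.rpow_mul (by norm_num)]
    congr 1; ring
  rw [h]
  exact stmt_all k
end
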